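/- arXiv:2510.04501 — 2 statements merged into one kernel-verified Lean document; each statement's English description precedes it below -/
import Mathlib

section
/- For any d > 0, any a, c > 0 with a < 1/c, and any wave speed s ≥ s* := max{2, 2√(a·d)}, there exists δ = δ(a, c, s) with 0 < δ < a such that for every b with δ < b < a there exists a positive twice continuously differentiable solution (u, v) of u'' − s·u' + u·(1 − u − c·v) = 0 and d·v'' − s·v' + v·(a − b·u − v) = 0 on ℝ with lim_{ξ→−∞}(u, v) = (0, 0) and lim_{ξ→+∞}(u, v) = (u*, v*), for which the component v is not monotone on ℝ (v is neither nondecreasing on ℝ nor nonincreasing on ℝ). -/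
open Filter Real

lemma aux_pos_right {f : ℝ → ℝ} {f' x : ℝ} (h : HasDerivAt f f' x) (hf : 0 < f') :
    ∀ᶠ y in nhdsWithin x (Set.Ioi x), f x < f y := by
  have h1 := (hasDerivAt_iff_tendsto_slope.1 h).mono_left
    (nhdsWithin_mono x (fun y (hy : x < y) => (ne_of_gt hy : y ∈ ({x}ᶜ : Set ℝ))))
  filter_upwards [h1.eventually (lt_mem_nhds hf), self_mem_nhdsWithin] with y hy hxy
  rw [slope_def_field] at hy
  have hxy' : 0 < y - x := sub_pos.2 hxy
  have := (div_pos_iff_of_pos_right hxy').1 hy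
  linarith

lemma aux_pos_left {f : ℝ → ℝ} {f' x : ℝ} (h : HasDerivAt f f' x) (hf : 0 < f') :
    ∀ᶠ y in nhdsWithin x (Set.Iio x), f y < f x := by
  have h1 := (hasDerivAt_iff_tendsto_slope.1 h).mono_left
    (nhdsWithin_mono x (fun y (hy : y < x) => (ne_of_lt hy : y ∈ ({x}ᶜ : Set ℝ))))
  filter_upwards [h1.eventually (lt_mem_nhds hf), self_mem_nhdsWithin] with y hy hxy
  rw [slope_def_field] at hy
  have hxy' : y - x < 0 := sub_neg.2 hxy
  by_contra hc
  have : (f y - f x) / (y - x) ≤ 0 := div_nonpos_of_nonneg_of_nonpos (by linarith) hxy'.le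
  linarith

lemma aux_anti {f f' : ℝ → ℝ} {x y : ℝ} (hxy : x ≤ y)
    (h : ∀ t, x ≤ t → t ≤ y → HasDerivAt f (f' t) t)
    (h' : ∀ t, x ≤ t → t ≤ y → f' t ≤ 0) : f y ≤ f x := by
  have : AntitoneOn f (Set.Icc x y) := by
    apply antitoneOn_of_deriv_nonpos (convex_Icc x y)
    · exact fun t ht => (h t ht.1 ht.2).continuousAt.continuousWithinAt
    · intro t ht
      rw [interior_Icc] at ht
      exact (h t ht.1.le ht.2.le).differentiableAt.differentiableWithinAt
    · intro t ht
      rw [interior_Icc] at ht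
      rw [(h t ht.1.le ht.2.le).deriv]
      exact h' t ht.1.le ht.2.le
  exact this (Set.left_mem_Icc.2 hxy) (Set.right_mem_Icc.2 hxy) hxy

lemma aux_mono {f f' : ℝ → ℝ} {x y : ℝ} (hxy : x ≤ y)
    (h : ∀ t, x ≤ t → t ≤ y → HasDerivAt f (f' t) t)
    (h' : ∀ t, x ≤ t → t ≤ y → 0 ≤ f' t) : f x ≤ f y := by
  have := aux_anti (f := fun t => - f t) (f' := fun t => - f' t) hxy
    (fun t h1 h2 => (h t h1 h2).neg) (fun t h1 h2 => by have := h' t h1 h2; linarith)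
  linarith

/-- integrated differential inequality -/
lemma aux_int {u p r : ℝ → ℝ} {d s m x y : ℝ} (hxy : x ≤ y)
    (hu : ∀ t, x ≤ t → t ≤ y → HasDerivAt u (p t) t)
    (hp : ∀ t, x ≤ t → t ≤ y → HasDerivAt p (r t) t)
    (h : ∀ t, x ≤ t → t ≤ y → m ≤ d * r t - s * p t) :
    d * p x - s * u x + m * (y - x) ≤ d * p y - s * u y := by
  have := aux_mono (f := fun t => d * p t - s * u t - m * t)
    (f' := fun t => d * r t - s * p t - m) hxy
    (fun t h1 h2 => by
      have := (((hp t h1 h2).const_mul d).sub ((hu t h1 h2).const_mul s)).sub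
        ((hasDerivAt_id t).const_mul m)
      rw [mul_one] at this
      exact this) (fun t h1 h2 => by have := h t h1 h2; linarith)
  linarith

lemma aux_trap {z p r : ℝ → ℝ} {d s m X B θ : ℝ} (hd : 0 < d) (hs : 0 < s) (hm : 0 < m)
    (hz : ∀ t, X ≤ t → HasDerivAt z (p t) t)
    (hp : ∀ t, X ≤ t → HasDerivAt p (r t) t)
    (hB : ∀ t, X ≤ t → |z t| ≤ B)
    (h : ∀ t, X ≤ t → θ < z t → m ≤ d * r t - s * p t) :
    ∃ Y, X ≤ Y ∧ ∀ t, Y ≤ t → z t ≤ θ := by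
  have hB0 : 0 ≤ B := (abs_nonneg _).trans (hB X le_rfl)
  have hBu : ∀ t, X ≤ t → z t ≤ B := fun t ht => (abs_le.1 (hB t ht)).2
  have hBl : ∀ t, X ≤ t → -B ≤ z t := fun t ht => (abs_le.1 (hB t ht)).1
  -- right increase
  have hR : ∀ t, X ≤ t → θ < z t → 0 ≤ p t → ∃ η, t < η ∧ ∀ y, t < y → y < η → z t < z y := by
    intro t ht hθ hpt
    have hr : 0 < r t := by
      have h1 := h t ht hθ
      have h2 : 0 ≤ s * p t := by positivity
      have h3 : 0 < d * r t := by linarith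
      exact (mul_pos_iff_of_pos_left hd).1 h3
    have h1 := aux_pos_right (hp t ht) hr
    rw [eventually_nhdsWithin_iff] at h1
    obtain ⟨ε, hε, h2⟩ := Metric.eventually_nhds_iff.1 h1
    refine ⟨t + ε, by linarith, fun y h3 h4 => ?_⟩
    have h5 : ∀ x, t < x → x ≤ y → 0 < p x := fun x hx1 hx2 => by
      have := h2 (y := x) (by rw [Real.dist_eq, abs_lt]; constructor <;> linarith) hx1
      linarith
    have : StrictMonoOn z (Set.Icc t y) := by
      apply strictMonoOn_of_deriv_pos (convex_Icc t y)
      · exact fun x hx => (hz x (ht.trans hx.1)).continuousAt.continuousWithinAt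
      · intro x hx
        rw [interior_Icc] at hx
        rw [(hz x (ht.trans hx.1.le)).deriv]
        exact h5 x hx.1 hx.2.le
    exact this (Set.left_mem_Icc.2 h3.le) (Set.right_mem_Icc.2 h3.le) h3
  have hA : ∀ t, X ≤ t → θ < z t → p t < 0 := by
    intro t ht hθ
    by_contra hpt
    push Not at hpt
    have hgt : ∀ y, t < y → z t < z y := by
      intro y hy
      by_contra hc
      push Not at hc
      obtain ⟨ξ, hξ, hmax⟩ := (isCompact_Icc (a := t) (b := y)).exists_isMaxOn
        (Set.nonempty_Icc.2 hy.le)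
        (fun x hx => (hz x (ht.trans hx.1)).continuousAt.continuousWithinAt)
      obtain ⟨η, h1, h2⟩ := hR t ht hθ hpt
      have h3 : z t < z ξ := by
        have h4 := h2 (min ((t + η) / 2) y) (lt_min (by linarith) hy)
          ((min_le_left _ _).trans_lt (by linarith))
        exact h4.trans_le (hmax ⟨(lt_min (by linarith) hy).le, min_le_right _ _⟩)
      have h5 : t < ξ := lt_of_le_of_ne hξ.1 (fun e => by rw [e] at h3; exact lt_irrefl _ h3)
      have h6 : ξ < y := lt_of_le_of_ne hξ.2 (fun e => by rw [← e] at hc; linarith)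
      have h7 : IsLocalMax z ξ := hmax.isLocalMax (Icc_mem_nhds h5 h6)
      have h8 := h7.hasDerivAt_eq_zero (hz ξ (ht.trans h5.le))
      obtain ⟨η', h9, h10⟩ := hR ξ (ht.trans h5.le) (hθ.trans h3) h8.ge
      have h11 := h10 (min ((ξ + η') / 2) y) (lt_min (by linarith) h6)
          ((min_le_left _ _).trans_lt (by linarith))
      have h12 : z (min ((ξ + η') / 2) y) ≤ z ξ :=
        hmax ⟨h5.le.trans (lt_min (by linarith) h6).le, min_le_right _ _⟩
      linarith
    have hge : ∀ y, t ≤ y → θ < z y := fun y hy => by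
      rcases hy.eq_or_lt with rfl | hy
      · exact hθ
      · exact hθ.trans (hgt y hy)
    have hint : ∀ y, t ≤ y → d * p t - s * z t + m * (y - t) ≤ d * p y - s * z y := fun y hy =>
      aux_int hy (fun x h1 _ => hz x (ht.trans h1)) (fun x h1 _ => hp x (ht.trans h1))
        (fun x h1 _ => h x (ht.trans h1) (hge x h1))
    obtain ⟨Y, hY1, hY2⟩ : ∃ Y, t ≤ Y ∧ ∀ y, Y ≤ y → 1 ≤ p y := by
      refine ⟨t + (d + 2 * s * B) / m, by
        have : 0 ≤ (d + 2 * s * B) / m := by positivity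
        linarith, fun y hy => ?_⟩
      have hty : t ≤ y := by
        have : 0 ≤ (d + 2 * s * B) / m := by positivity
        linarith
      have h1 := hint y hty
      have h2 : (d + 2 * s * B) ≤ m * (y - t) := by
        have : (d + 2 * s * B) / m ≤ y - t := by linarith
        rw [div_le_iff₀ hm] at this
        linarith
      have h3 : 0 ≤ d * p t := by positivity
      have h4 : s * z t ≤ s * B := mul_le_mul_of_nonneg_left (hBu t ht) hs.le
      have h5 : s * (-B) ≤ s * z y := mul_le_mul_of_nonneg_left (hBl y (ht.trans hty)) hs.le
      have h6 : d * 1 ≤ d * p y := by linarith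
      exact le_of_mul_le_mul_left h6 hd
    have h1 := aux_mono (f := fun x => z x - x) (f' := fun x => p x - 1)
      (x := Y) (y := Y + 2 * B + 1) (by linarith)
      (fun x h1 _ => (hz x (ht.trans (hY1.trans h1))).sub (hasDerivAt_id x))
      (fun x h1 _ => by have := hY2 x h1; linarith)
    have h2 := hBl Y (ht.trans hY1)
    have h3 := hBu (Y + 2 * B + 1) (by linarith)
    linarith
  obtain ⟨Y, hXY, hY⟩ : ∃ Y, X ≤ Y ∧ z Y ≤ θ := by
    by_contra hc
    push Not at hc
    set y := X + (|d * p X| + 2 * s * B + 1) / m with hy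
    have hXy : X ≤ y := by
      have : 0 ≤ (|d * p X| + 2 * s * B + 1) / m := by positivity
      linarith
    have h1 := aux_int (m := m) (d := d) (s := s) hXy (fun x h1 _ => hz x h1)
      (fun x h1 _ => hp x h1) (fun x h1 _ => h x h1 (hc x h1))
    have h2 : m * (y - X) = |d * p X| + 2 * s * B + 1 := by
      rw [hy]; field_simp; ring
    have h3 : d * p y ≤ 0 := mul_nonpos_of_nonneg_of_nonpos hd.le (hA y hXy (hc y hXy)).le
    have h4 : s * z X ≤ s * B := mul_le_mul_of_nonneg_left (hBu X le_rfl) hs.le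
    have h5 : s * (-B) ≤ s * z y := mul_le_mul_of_nonneg_left (hBl y hXy) hs.le
    have h6 := neg_abs_le (d * p X)
    linarith
  refine ⟨Y, hXY, fun t ht => ?_⟩
  by_contra hc
  push Not at hc
  obtain ⟨ξ, hξ, hmax⟩ := (isCompact_Icc (a := Y) (b := t)).exists_isMaxOn
    (Set.nonempty_Icc.2 ht)
    (fun x hx => (hz x (hXY.trans hx.1)).continuousAt.continuousWithinAt)
  have h1 : θ < z ξ := hc.trans_le (hmax (Set.right_mem_Icc.2 ht))
  have h2 : Y < ξ := lt_of_le_of_ne hξ.1 (fun e => by rw [e] at hY; linarith)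
  have h3 := aux_pos_left (hz ξ (hXY.trans hξ.1)).neg
    (by have := hA ξ (hXY.trans hξ.1) h1; linarith)
  obtain ⟨y, h4, h5⟩ := (h3.and (Ioo_mem_nhdsLT h2)).exists
  have h6 : z y ≤ z ξ := hmax ⟨h5.1.le, h5.2.le.trans hξ.2⟩
  simp only [Pi.neg_apply] at h4
  linarith

lemma aux_glue {f g f' g' : ℝ → ℝ} (hf : ∀ t, 0 ≤ t → HasDerivAt f (f' t) t)
    (hg : ∀ t, t ≤ 0 → HasDerivAt g (g' t) t) (h0 : f 0 = g 0) (h0' : f' 0 = g' 0) (x : ℝ) :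
    HasDerivAt (fun t => if 0 ≤ t then f t else g t) (if 0 ≤ x then f' x else g' x) x := by
  rcases lt_trichotomy x 0 with hx | hx | hx
  · rw [if_neg (not_le.2 hx)]
    refine (hg x hx.le).congr_of_eventuallyEq ?_
    filter_upwards [Iio_mem_nhds hx] with t ht
    rw [if_neg (not_le.2 ht)]
  · subst hx
    rw [if_pos le_rfl, ← hasDerivWithinAt_univ, ← Set.Iic_union_Ici (a := (0:ℝ))]
    apply HasDerivWithinAt.union
    · rw [h0']
      refine (hg 0 le_rfl).hasDerivWithinAt.congr ?_ (by simp [h0])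
      intro t ht
      rcases (show t ≤ 0 from ht).eq_or_lt with rfl | ht
      · simp [h0]
      · rw [if_neg (not_le.2 ht)]
    · refine (hf 0 le_rfl).hasDerivWithinAt.congr ?_ (by simp)
      intro t ht
      exact if_pos ht
  · rw [if_pos hx.le]
    refine (hf x hx.le).congr_of_eventuallyEq ?_
    filter_upwards [Ioi_mem_nhds hx] with t ht
    rw [if_pos (le_of_lt ht)]

/-- backward invariance -/
lemma aux_back {ι : Type} [Finite ι] {h h' : ι → ℝ → ℝ}
    (hd : ∀ i t, HasDerivAt (h i) (h' i t) t) (h0 : ∀ i, 0 < h i 0)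
    (hb : ∀ t, t ≤ 0 → (∀ i x, t ≤ x → x ≤ 0 → 0 ≤ h i x) → ∀ i, h i t = 0 → h' i t < 0) :
    ∀ t, t ≤ 0 → ∀ i, 0 < h i t := by
  by_contra hc
  push Not at hc
  obtain ⟨t0, ht0, i0, hi0⟩ := hc
  have hcont : ∀ i, Continuous (h i) := fun i =>
    continuous_iff_continuousAt.2 fun t => (hd i t).continuousAt
  set S : Set ℝ := Set.Icc t0 0 ∩ ⋃ i, {t | h i t ≤ 0} with hS
  have hSc : IsCompact S := isCompact_Icc.inter_right
    (isClosed_iUnion_of_finite fun i => isClosed_le (hcont i) continuous_const)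
  have hSne : S.Nonempty := ⟨t0, ⟨le_rfl, ht0⟩, Set.mem_iUnion.2 ⟨i0, hi0⟩⟩
  obtain ⟨t1, ht1, hmax⟩ := hSc.exists_isGreatest hSne
  obtain ⟨j, hj⟩ := Set.mem_iUnion.1 ht1.2
  have hj' : h j t1 ≤ 0 := hj
  have hlt : t1 < 0 := lt_of_le_of_ne ht1.1.2 (fun e => by
    rw [e] at hj'; exact absurd (h0 j) (not_lt.2 hj'))
  have hpos : ∀ i x, t1 < x → x ≤ 0 → 0 < h i x := by
    intro i x h1 h2
    by_contra h3
    push Not at h3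
    exact absurd (hmax ⟨⟨ht1.1.1.trans h1.le, h2⟩, Set.mem_iUnion.2 ⟨i, h3⟩⟩) (not_le.2 h1)
  have hge : ∀ i x, t1 ≤ x → x ≤ 0 → 0 ≤ h i x := by
    intro i x h1 h2
    rcases h1.eq_or_lt with rfl | h1
    · refine ge_of_tendsto ((hcont i).continuousAt.tendsto.mono_left
        (nhdsWithin_le_nhds (s := Set.Ioi t1))) ?_
      filter_upwards [Ioo_mem_nhdsGT hlt] with y hy
      exact (hpos i y hy.1 hy.2.le).le
    · exact (hpos i x h1 h2).le
  have hj0 : h j t1 = 0 := le_antisymm hj' (hge j t1 le_rfl hlt.le)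
  have hneg := hb t1 hlt.le hge j hj0
  have := aux_pos_right (hd j t1).neg (by linarith)
  obtain ⟨y, h1, h2⟩ := (this.and (Ioo_mem_nhdsGT hlt)).exists
  have := hpos j y h2.1 h2.2.le
  simp only [Pi.neg_apply] at h1
  linarith

lemma aux_global {E : Type*} [NormedAddCommGroup E] [NormedSpace ℝ E] [CompleteSpace E]
    (Φ : E → E) (K : NNReal) (hK : LipschitzWith K Φ) (L : NNReal) (hL : ∀ x, ‖Φ x‖ ≤ L)
    (x0 : E) : ∃ y : ℝ → E, y 0 = x0 ∧ ∀ t, HasDerivAt y (Φ (y t)) t := by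
  have hloc : ∀ n : ℕ, ∃ y : ℝ → E, y 0 = x0 ∧
      ∀ t ∈ Set.Ioo (-(n + 1 : ℝ)) (n + 1), HasDerivAt y (Φ (y t)) t := by
    intro n
    have hmem : (0 : ℝ) ∈ Set.Icc (-(n + 1 : ℝ)) (n + 1) := by
      constructor <;> [have := n.cast_nonneg (α := ℝ); have := n.cast_nonneg (α := ℝ)] <;> linarith
    have hpl : IsPicardLindelof (fun _ => Φ) (tmin := -(n + 1 : ℝ)) (tmax := n + 1)
        ⟨0, hmem⟩ x0 (L * (n + 1)) 0 L K :=
      { lipschitzOnWith := fun t _ => hK.lipschitzOnWith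
        continuousOn := fun x _ => continuousOn_const
        norm_le := fun t _ x _ => hL x
        mul_max_le := by simp }
    obtain ⟨y, h1, h2⟩ := hpl.exists_eq_forall_mem_Icc_hasDerivWithinAt₀
    exact ⟨y, h1, fun t ht => (h2 t ⟨ht.1.le, ht.2.le⟩).hasDerivAt (Icc_mem_nhds ht.1 ht.2)⟩
  choose y hy0 hy using hloc
  have huniq : ∀ m n : ℕ, m ≤ n → Set.EqOn (y m) (y n) (Set.Ioo (-(m + 1 : ℝ)) (m + 1)) := by
    intro m n hmn
    have hmn' : (m : ℝ) ≤ n := by exact_mod_cast hmn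
    have hm0 := m.cast_nonneg (α := ℝ)
    refine ODE_solution_unique_of_mem_Ioo (v := fun _ => Φ) (s := fun _ => Set.univ) (K := K)
      (t₀ := 0) (fun t _ => hK.lipschitzOnWith) ⟨by linarith, by linarith⟩
      (fun t ht => ⟨hy m t ht, trivial⟩)
      (fun t ht => ⟨hy n t ⟨by linarith [ht.1], by linarith [ht.2]⟩, trivial⟩) ?_
    rw [hy0, hy0]
  have hmem : ∀ t : ℝ, t ∈ Set.Ioo (-(⌈|t|⌉₊ + 1 : ℝ)) (⌈|t|⌉₊ + 1) := fun t => by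
    have := Nat.le_ceil |t|
    have h2 := abs_le.1 this
    constructor <;> linarith
  refine ⟨fun t => y ⌈|t|⌉₊ t, by simp [hy0], fun t => ?_⟩
  set n := ⌈|t|⌉₊ with hn
  have hev : (fun t => y ⌈|t|⌉₊ t) =ᶠ[nhds t] y n := by
    filter_upwards [isOpen_Ioo.mem_nhds (hmem t)] with x hx
    rcases le_total n ⌈|x|⌉₊ with h | h
    · exact (huniq _ _ h hx).symm
    · exact huniq _ _ h (hmem x)
  exact (hy n t (hmem t)).congr_of_eventuallyEq hev

lemma aux_clamp_exists (Φ : ℝ × ℝ × ℝ × ℝ → ℝ × ℝ × ℝ × ℝ) (hΦ : ContDiff ℝ 1 Φ) (R : ℝ) (hR : 0 ≤ R)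
    (hΦ1 : ∀ x, 0 ≤ x.2.1 → 0 ≤ (Φ x).1) (hΦ3 : ∀ x, 0 ≤ x.2.2.2 → 0 ≤ (Φ x).2.2.1)
    (x0 : ℝ × ℝ × ℝ × ℝ) : ∃ u p v q : ℝ → ℝ, (u 0, p 0, v 0, q 0) = x0 ∧
      ∃ u' p' v' q' : ℝ → ℝ, (∀ t, HasDerivAt u (u' t) t) ∧ (∀ t, HasDerivAt p (p' t) t) ∧
      (∀ t, HasDerivAt v (v' t) t) ∧ (∀ t, HasDerivAt q (q' t) t) ∧
      (∀ t, 0 ≤ u' t) ∧ (∀ t, 0 ≤ v' t) ∧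
      ∀ t, 0 ≤ u t → u t ≤ R → 0 ≤ p t → p t ≤ R → 0 ≤ v t → v t ≤ R → 0 ≤ q t → q t ≤ R →
        (u' t, p' t, v' t, q' t) = Φ (u t, p t, v t, q t) := by
  let c : ℝ → ℝ := fun x => max 0 (min x R)
  have hc : LipschitzWith 1 c := (LipschitzWith.id.min_const R).const_max 0
  have hcm : ∀ x, c x ∈ Set.Icc 0 R := fun x => ⟨le_max_left _ _, max_le hR (min_le_right _ _)⟩
  have hce : ∀ x, 0 ≤ x → x ≤ R → c x = x := fun x h1 h2 => by
    simp only [c]; rw [min_eq_left h2, max_eq_right h1]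
  let C : ℝ × ℝ × ℝ × ℝ → ℝ × ℝ × ℝ × ℝ := fun x => (c x.1, c x.2.1, c x.2.2.1, c x.2.2.2)
  have hC : LipschitzWith 1 C := by
    rw [lipschitzWith_iff_dist_le_mul]
    intro x y
    have hc' := fun a b => lipschitzWith_iff_dist_le_mul.1 hc a b
    simp only [NNReal.coe_one, one_mul] at hc' ⊢
    simp only [Prod.dist_eq, C]
    exact max_le_max (hc' _ _) (max_le_max (hc' _ _) (max_le_max (hc' _ _) (hc' _ _)))
  let S : Set (ℝ × ℝ × ℝ × ℝ) := Set.Icc 0 R ×ˢ Set.Icc 0 R ×ˢ Set.Icc 0 R ×ˢ Set.Icc 0 R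
  have hS : IsCompact S := isCompact_Icc.prod (isCompact_Icc.prod (isCompact_Icc.prod isCompact_Icc))
  have hSconv : Convex ℝ S := (convex_Icc 0 R).prod ((convex_Icc 0 R).prod
    ((convex_Icc 0 R).prod (convex_Icc 0 R)))
  have hCS : ∀ x, C x ∈ S := fun x => ⟨hcm _, hcm _, hcm _, hcm _⟩
  obtain ⟨K, hK⟩ : ∃ K, LipschitzOnWith K Φ S := by
    exact hΦ.contDiffOn.exists_lipschitzOnWith one_ne_zero hSconv hS
  obtain ⟨M, hM⟩ := hS.exists_bound_of_continuousOn hΦ.continuous.continuousOn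
  have hL : LipschitzWith (K * 1) (Φ ∘ C) := by
    have := hK.comp (hC.lipschitzOnWith (s := Set.univ)) (fun x _ => hCS x)
    exact lipschitzOnWith_univ.1 this
  obtain ⟨y, hy0, hy⟩ := aux_global (Φ ∘ C) _ hL (Real.toNNReal M)
    (fun x => (hM _ (hCS x)).trans (Real.le_coe_toNNReal M)) x0
  refine ⟨fun t => (y t).1, fun t => (y t).2.1, fun t => (y t).2.2.1, fun t => (y t).2.2.2, hy0,
    fun t => (Φ (C (y t))).1, fun t => (Φ (C (y t))).2.1, fun t => (Φ (C (y t))).2.2.1,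
    fun t => (Φ (C (y t))).2.2.2, fun t => ?_, fun t => ?_, fun t => ?_, fun t => ?_,
    fun t => hΦ1 _ (hcm _).1, fun t => hΦ3 _ (hcm _).1, ?_⟩
  · exact (hy t).fst
  · exact (hy t).snd.fst
  · exact (hy t).snd.snd.fst
  · exact (hy t).snd.snd.snd
  · intro t h1 h2 h3 h4 h5 h6 h7 h8
    have : C (y t) = y t := by
      simp only [C]
      rw [hce _ h1 h2, hce _ h3 h4, hce _ h5 h6, hce _ h7 h8]
    show Φ (C (y t)) = Φ (y t)
    rw [this]

noncomputable def auxW (l : ℝ) (f : ℝ → ℝ) (t : ℝ) : ℝ :=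
  exp (l * t) * ∫ τ in Set.Ioi t, exp (-l * τ) * f τ

noncomputable def auxU (m w0 : ℝ) (w : ℝ → ℝ) (x : ℝ) : ℝ :=
  exp (-m * x) * (w0 + ∫ t in (0:ℝ)..x, exp (m * t) * w t)

lemma auxW_integrable {l : ℝ} (hl : 0 < l) {f : ℝ → ℝ} (hf : Measurable f) {C : ℝ}
    (hC : ∀ t, |f t| ≤ C) (t : ℝ) :
    MeasureTheory.IntegrableOn (fun τ => exp (-l * τ) * f τ) (Set.Ioi t) := by
  have h1 := integrableOn_exp_mul_Ioi (a := -l) (by linarith) t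
  exact MeasureTheory.Integrable.mul_bdd (c := C) h1 hf.aestronglyMeasurable
    (Filter.Eventually.of_forall fun x => by rw [Real.norm_eq_abs]; exact hC x)

lemma auxW_const {l : ℝ} (hl : 0 < l) (k t : ℝ) : auxW l (fun _ => k) t = k / l := by
  unfold auxW
  rw [MeasureTheory.integral_mul_const, integral_exp_mul_Ioi (by linarith : -l < 0)]
  have : exp (l * t) * exp (-l * t) = 1 := by rw [← exp_add]; simp
  calc exp (l * t) * (-exp (-l * t) / -l * k) = (exp (l * t) * exp (-l * t)) * (k / l) := by
        field_simp
    _ = k / l := by rw [this, one_mul]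

lemma auxW_mono {l : ℝ} (hl : 0 < l) {f g : ℝ → ℝ} (hf : Measurable f) (hg : Measurable g) {C : ℝ}
    (hfC : ∀ t, |f t| ≤ C) (hgC : ∀ t, |g t| ≤ C) (h : ∀ t, f t ≤ g t) (t : ℝ) :
    auxW l f t ≤ auxW l g t := by
  unfold auxW
  refine mul_le_mul_of_nonneg_left ?_ (exp_pos _).le
  exact MeasureTheory.integral_mono (auxW_integrable hl hf hfC t) (auxW_integrable hl hg hgC t)
    (fun τ => mul_le_mul_of_nonneg_left (h τ) (exp_pos _).le)

lemma auxW_abs {l : ℝ} (hl : 0 < l) {f : ℝ → ℝ} (hf : Measurable f) {k K : ℝ}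
    (h1 : ∀ t, k ≤ f t) (h2 : ∀ t, f t ≤ K) (t : ℝ) :
    k / l ≤ auxW l f t ∧ auxW l f t ≤ K / l := by
  have hb : ∀ x, k ≤ x → x ≤ K → |x| ≤ max |k| |K| := fun x hx1 hx2 => abs_le_max_abs_abs hx1 hx2
  have hkK := (h1 0).trans (h2 0)
  rw [← auxW_const hl k t, ← auxW_const hl K t]
  exact ⟨auxW_mono hl measurable_const hf (C := max |k| |K|) (fun _ => hb _ le_rfl hkK)
    (fun t => hb _ (h1 t) (h2 t)) h1 t, auxW_mono hl hf measurable_const (C := max |k| |K|)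
    (fun t => hb _ (h1 t) (h2 t)) (fun _ => hb _ hkK le_rfl) h2 t⟩

lemma auxW_tendsto {l : ℝ} (hl : 0 < l) {f : ℕ → ℝ → ℝ} {g : ℝ → ℝ} (hf : ∀ n, Measurable (f n))
    {C : ℝ} (hfC : ∀ n t, |f n t| ≤ C) (h : ∀ t, Tendsto (fun n => f n t) atTop (nhds (g t)))
    (t : ℝ) : Tendsto (fun n => auxW l (f n) t) atTop (nhds (auxW l g t)) := by
  unfold auxW
  refine Tendsto.const_mul _ ?_
  refine MeasureTheory.tendsto_integral_of_dominated_convergence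
    (fun τ => exp (-l * τ) * C) (fun n => ?_) ?_ (fun n => ?_) ?_
  · exact (auxW_integrable hl (hf n) (hfC n) t).aestronglyMeasurable
  · exact (integrableOn_exp_mul_Ioi (a := -l) (by linarith) t).mul_const C
  · refine Filter.Eventually.of_forall fun τ => ?_
    rw [norm_mul, Real.norm_eq_abs, Real.norm_eq_abs, abs_of_pos (exp_pos _)]
    exact mul_le_mul_of_nonneg_left (hfC n τ) (exp_pos _).le
  · exact Filter.Eventually.of_forall fun τ => (h τ).const_mul _

lemma auxW_eq {l : ℝ} (hl : 0 < l) {f : ℝ → ℝ} (hf : Measurable f) {C : ℝ}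
    (hC : ∀ t, |f t| ≤ C) (t : ℝ) : auxW l f t = exp (l * t) *
      ((∫ τ in Set.Ioi 0, exp (-l * τ) * f τ) - ∫ τ in (0:ℝ)..t, exp (-l * τ) * f τ) := by
  unfold auxW
  rw [← intervalIntegral.integral_Ioi_sub_Ioi' (auxW_integrable hl hf hC 0)
    (auxW_integrable hl hf hC t)]
  ring

lemma auxW_ii {l : ℝ} {f : ℝ → ℝ} (hf : Measurable f) {C : ℝ}
    (hC : ∀ t, |f t| ≤ C) (x y : ℝ) :
    IntervalIntegrable (fun τ => exp (l * τ) * f τ) MeasureTheory.volume x y := by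
  have h1 : IntervalIntegrable (fun τ => exp (l * τ)) MeasureTheory.volume x y :=
    Continuous.intervalIntegrable (by fun_prop) _ _
  rw [intervalIntegrable_iff] at h1 ⊢
  exact MeasureTheory.Integrable.mul_bdd (c := C) h1 hf.aestronglyMeasurable
    (Filter.Eventually.of_forall fun x => by rw [Real.norm_eq_abs]; exact hC x)

lemma auxW_cont {l : ℝ} (hl : 0 < l) {f : ℝ → ℝ} (hf : Measurable f) {C : ℝ}
    (hC : ∀ t, |f t| ≤ C) : Continuous (auxW l f) := by
  rw [funext (auxW_eq hl hf hC)]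
  have := intervalIntegral.continuous_primitive (fun x y => auxW_ii (l := -l) hf hC x y) 0
  fun_prop

lemma auxW_deriv {l : ℝ} (hl : 0 < l) {f : ℝ → ℝ} (hf : Continuous f) {C : ℝ}
    (hC : ∀ t, |f t| ≤ C) (t : ℝ) : HasDerivAt (auxW l f) (l * auxW l f t - f t) t := by
  have h0 := funext (auxW_eq hl hf.measurable hC)
  have hcont : Continuous (fun τ => exp (-l * τ) * f τ) := by fun_prop
  have h1 : HasDerivAt (fun t => ∫ τ in (0:ℝ)..t, exp (-l * τ) * f τ) (exp (-l * t) * f t) t :=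
    intervalIntegral.integral_hasDerivAt_right (hcont.intervalIntegrable _ _)
      (hcont.stronglyMeasurableAtFilter _ _) hcont.continuousAt
  have h2 : HasDerivAt (fun t => exp (l * t)) (exp (l * t) * l) t := by
    simpa using ((hasDerivAt_id t).const_mul l).exp
  have h3 := h2.mul (h1.const_sub (∫ τ in Set.Ioi 0, exp (-l * τ) * f τ))
  have h4 : exp (l * t) * exp (-l * t) = 1 := by rw [← exp_add]; simp
  rw [auxW_eq hl hf.measurable hC t]
  rw [h0]
  refine h3.congr_deriv ?_
  linear_combination (-f t) * h4

lemma auxU_deriv {m w0 : ℝ} {w : ℝ → ℝ} (hw : Continuous w) (x : ℝ) :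
    HasDerivAt (auxU m w0 w) (-m * auxU m w0 w x + w x) x := by
  have hcont : Continuous (fun τ => exp (m * τ) * w τ) := by fun_prop
  have h1 : HasDerivAt (fun t => ∫ τ in (0:ℝ)..t, exp (m * τ) * w τ) (exp (m * x) * w x) x :=
    intervalIntegral.integral_hasDerivAt_right (hcont.intervalIntegrable _ _)
      (hcont.stronglyMeasurableAtFilter _ _) hcont.continuousAt
  have h2 : HasDerivAt (fun t => exp (-m * t)) (exp (-m * x) * (-m)) x := by
    simpa using ((hasDerivAt_id x).const_mul (-m)).exp
  have h3 := h2.mul (h1.const_add w0)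
  have h4 : exp (-m * x) * exp (m * x) = 1 := by rw [← exp_add]; simp
  unfold auxU
  refine h3.congr_deriv ?_
  linear_combination (w x) * h4

lemma auxU_cont {m w0 : ℝ} {w : ℝ → ℝ} (hw : Continuous w) : Continuous (auxU m w0 w) :=
  continuous_iff_continuousAt.2 fun x => (auxU_deriv hw x).continuousAt

lemma auxU_zero {m w0 : ℝ} {w : ℝ → ℝ} : auxU m w0 w 0 = w0 := by
  unfold auxU; simp

lemma auxU_mono {m w0 : ℝ} {w w' : ℝ → ℝ} (hw : Continuous w) (hw' : Continuous w')
    (h : ∀ t, w t ≤ w' t) (x : ℝ) (hx : 0 ≤ x) : auxU m w0 w x ≤ auxU m w0 w' x := by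
  unfold auxU
  refine mul_le_mul_of_nonneg_left ?_ (exp_pos _).le
  have : (∫ t in (0:ℝ)..x, exp (m * t) * w t) ≤ ∫ t in (0:ℝ)..x, exp (m * t) * w' t := by
    refine intervalIntegral.integral_mono hx (Continuous.intervalIntegrable (by fun_prop) _ _)
      (Continuous.intervalIntegrable (by fun_prop) _ _)
      (fun t => mul_le_mul_of_nonneg_left (h t) (exp_pos _).le)
  linarith

lemma auxU_ge {m w0 k : ℝ} {w : ℝ → ℝ} (hw : Continuous w) (hk : k ≤ w0)
    (h : ∀ t, m * k ≤ w t) (x : ℝ) (hx : 0 ≤ x) : k ≤ auxU m w0 w x := by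
  have hE : ∀ t, HasDerivAt (fun t => exp (m * t)) (exp (m * t) * m) t := fun t => by
    simpa using ((hasDerivAt_id t).const_mul m).exp
  have := aux_mono (f := fun t => exp (m * t) * (auxU m w0 w t - k)) hx
    (fun t _ _ => (hE t).mul ((auxU_deriv hw t).sub_const k)) (fun t _ _ => by
      have h1 := mul_nonneg (exp_pos (m * t)).le (sub_nonneg.2 (h t))
      linarith)
  simp only [auxU_zero, mul_zero, exp_zero, one_mul] at this
  have h2 : 0 ≤ exp (m * x) * (auxU m w0 w x - k) := by linarith
  have h3 := nonneg_of_mul_nonneg_right h2 (exp_pos _)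
  linarith

lemma auxU_le {m w0 k : ℝ} {w : ℝ → ℝ} (hw : Continuous w) (hk : w0 ≤ k)
    (h : ∀ t, w t ≤ m * k) (x : ℝ) (hx : 0 ≤ x) : auxU m w0 w x ≤ k := by
  have hE : ∀ t, HasDerivAt (fun t => exp (m * t)) (exp (m * t) * m) t := fun t => by
    simpa using ((hasDerivAt_id t).const_mul m).exp
  have := aux_anti (f := fun t => exp (m * t) * (auxU m w0 w t - k)) hx
    (fun t _ _ => (hE t).mul ((auxU_deriv hw t).sub_const k)) (fun t _ _ => by
      have h1 := mul_nonneg (exp_pos (m * t)).le (sub_nonneg.2 (h t))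
      linarith)
  simp only [auxU_zero, mul_zero, exp_zero, one_mul] at this
  have h2 : 0 ≤ exp (m * x) * (k - auxU m w0 w x) := by linarith
  have h3 := nonneg_of_mul_nonneg_right h2 (exp_pos _)
  linarith

lemma auxU_tendsto {m w0 : ℝ} {w : ℕ → ℝ → ℝ} {g : ℝ → ℝ} (hw : ∀ n, Continuous (w n)) {C : ℝ}
    (hC : ∀ n t, |w n t| ≤ C) (h : ∀ t, Tendsto (fun n => w n t) atTop (nhds (g t))) (x : ℝ) :
    Tendsto (fun n => auxU m w0 (w n) x) atTop (nhds (auxU m w0 g x)) := by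
  unfold auxU
  refine Tendsto.const_mul _ (Tendsto.const_add _ ?_)
  refine intervalIntegral.tendsto_integral_filter_of_dominated_convergence
    (fun τ => exp (m * τ) * C) ?_ ?_ ?_ ?_
  · refine Filter.Eventually.of_forall fun n => Continuous.aestronglyMeasurable ?_
    have := hw n
    fun_prop
  · refine Filter.Eventually.of_forall fun n => Filter.Eventually.of_forall fun τ _ => ?_
    rw [norm_mul, Real.norm_eq_abs, Real.norm_eq_abs, abs_of_pos (exp_pos _)]
    exact mul_le_mul_of_nonneg_left (hC n τ) (exp_pos _).le
  · exact Continuous.intervalIntegrable (by fun_prop) _ _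
  · exact Filter.Eventually.of_forall fun τ _ => (h τ).const_mul _

/-- one step of the scalar solution operator -/
noncomputable def auxN (l m w0 : ℝ) (f : ℝ → ℝ) (x : ℝ) : ℝ := auxU m w0 (auxW l f) (max x 0)

lemma auxN_good {l m w0 k K : ℝ} (hl : 0 < l) (hk : k ≤ w0) (hK : w0 ≤ K) {f : ℝ → ℝ}
    (hf : Measurable f) (h1 : ∀ t, l * m * k ≤ f t) (h2 : ∀ t, f t ≤ l * m * K) :
    Continuous (auxN l m w0 f) ∧ ∀ x, k ≤ auxN l m w0 f x ∧ auxN l m w0 f x ≤ K := by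
  have hb : ∀ t, |f t| ≤ max |l * m * k| |l * m * K| :=
    fun t => abs_le_max_abs_abs (h1 t) (h2 t)
  have hc := auxW_cont hl hf hb
  refine ⟨?_, fun x => ⟨?_, ?_⟩⟩
  · exact (auxU_cont hc).comp (by fun_prop)
  · refine auxU_ge hc hk (fun t => ?_) _ (le_max_right _ _)
    have := (auxW_abs hl hf h1 h2 t).1
    rwa [mul_assoc, mul_div_cancel_left₀ _ hl.ne'] at this
  · refine auxU_le hc hK (fun t => ?_) _ (le_max_right _ _)
    have := (auxW_abs hl hf h1 h2 t).2
    rwa [mul_assoc l m K, mul_div_cancel_left₀ _ hl.ne'] at this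

lemma auxN_mono {l m w0 : ℝ} (hl : 0 < l) {f g : ℝ → ℝ}
    (hf : Measurable f) (hg : Measurable g) {C : ℝ} (hfC : ∀ t, |f t| ≤ C) (hgC : ∀ t, |g t| ≤ C)
    (h : ∀ t, f t ≤ g t) (x : ℝ) : auxN l m w0 f x ≤ auxN l m w0 g x :=
  auxU_mono (auxW_cont hl hf hfC) (auxW_cont hl hg hgC)
    (auxW_mono hl hf hg hfC hgC h) _ (le_max_right _ _)

lemma auxN_tendsto {l m w0 k K : ℝ} (hl : 0 < l) {f : ℕ → ℝ → ℝ} {g : ℝ → ℝ}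
    (hf : ∀ n, Measurable (f n)) (h1 : ∀ n t, k ≤ f n t) (h2 : ∀ n t, f n t ≤ K)
    (h : ∀ t, Tendsto (fun n => f n t) atTop (nhds (g t)))
    (x : ℝ) : Tendsto (fun n => auxN l m w0 (f n) x) atTop (nhds (auxN l m w0 g x)) := by
  have hb : ∀ n t, |f n t| ≤ max |k| |K| := fun n t => abs_le_max_abs_abs (h1 n t) (h2 n t)
  refine auxU_tendsto (C := max |k / l| |K / l|) (fun n => auxW_cont hl (hf n) (hb n))
    (fun n t => ?_) (fun t => auxW_tendsto hl hf hb h t) _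
  have := auxW_abs hl (hf n) (h1 n) (h2 n) t
  exact abs_le_max_abs_abs this.1 this.2

lemma auxN_sol {l m w0 k K : ℝ} (hl : 0 < l) {f : ℝ → ℝ} (hf : Continuous f)
    (h1 : ∀ t, k ≤ f t) (h2 : ∀ t, f t ≤ K) :
    ∃ u p : ℝ → ℝ, u 0 = w0 ∧ (∀ x, 0 ≤ x → u x = auxN l m w0 f x) ∧
      (∀ x, HasDerivAt u (p x) x) ∧
      ∀ x, HasDerivAt p ((l - m) * p x + l * m * u x - f x) x := by
  have hb : ∀ t, |f t| ≤ max |k| |K| := fun t => abs_le_max_abs_abs (h1 t) (h2 t)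
  have hc := auxW_cont hl hf.measurable hb
  refine ⟨auxU m w0 (auxW l f), fun x => -m * auxU m w0 (auxW l f) x + auxW l f x, auxU_zero,
    fun x hx => ?_, auxU_deriv hc, fun x => ?_⟩
  · unfold auxN; rw [max_eq_left hx]
  · have := ((auxU_deriv (m := m) (w0 := w0) hc x).const_mul (-m)).add (auxW_deriv hl hf hb x)
    refine this.congr_deriv ?_
    ring

lemma aux_half {l1 m1 l2 m2 a1 A1 a2 A2 u0 v0 : ℝ} (hl1 : 0 < l1) (hl2 : 0 < l2)
    (hu0 : a1 ≤ u0) (hu0' : u0 ≤ A1) (hv0 : a2 ≤ v0) (hv0' : v0 ≤ A2)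
    (F G : ℝ → ℝ → ℝ) (hFc : Continuous fun x : ℝ × ℝ => F x.1 x.2)
    (hGc : Continuous fun x : ℝ × ℝ => G x.1 x.2)
    (hF : ∀ u v u' v', a1 ≤ u → u ≤ u' → u' ≤ A1 → a2 ≤ v' → v' ≤ v → v ≤ A2 → F u v ≤ F u' v')
    (hG : ∀ u v u' v', a1 ≤ u → u ≤ u' → u' ≤ A1 → a2 ≤ v' → v' ≤ v → v ≤ A2 → G u' v' ≤ G u v)
    (hFb : ∀ u v, a1 ≤ u → u ≤ A1 → a2 ≤ v → v ≤ A2 →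
      l1 * m1 * a1 ≤ F u v ∧ F u v ≤ l1 * m1 * A1)
    (hGb : ∀ u v, a1 ≤ u → u ≤ A1 → a2 ≤ v → v ≤ A2 →
      l2 * m2 * a2 ≤ G u v ∧ G u v ≤ l2 * m2 * A2) :
    ∃ u p v q : ℝ → ℝ, u 0 = u0 ∧ v 0 = v0 ∧
      (∀ x, 0 ≤ x → a1 ≤ u x ∧ u x ≤ A1 ∧ a2 ≤ v x ∧ v x ≤ A2) ∧
      (∀ x, HasDerivAt u (p x) x) ∧
      (∀ x, 0 ≤ x → HasDerivAt p ((l1 - m1) * p x + l1 * m1 * u x - F (u x) (v x)) x) ∧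
      (∀ x, HasDerivAt v (q x) x) ∧
      (∀ x, 0 ≤ x → HasDerivAt q ((l2 - m2) * q x + l2 * m2 * v x - G (u x) (v x)) x) := by
  let N : (ℝ → ℝ) × (ℝ → ℝ) → (ℝ → ℝ) × (ℝ → ℝ) := fun z =>
    (auxN l1 m1 u0 (fun t => F (z.1 t) (z.2 t)), auxN l2 m2 v0 (fun t => G (z.1 t) (z.2 t)))
  let Box : (ℝ → ℝ) × (ℝ → ℝ) → Prop := fun z =>
    ∀ x, a1 ≤ z.1 x ∧ z.1 x ≤ A1 ∧ a2 ≤ z.2 x ∧ z.2 x ≤ A2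
  let Meas : (ℝ → ℝ) × (ℝ → ℝ) → Prop := fun z => Measurable z.1 ∧ Measurable z.2
  have hmF : ∀ z, Meas z → Measurable (fun t => F (z.1 t) (z.2 t)) := fun z hz =>
    hFc.measurable.comp (hz.1.prodMk hz.2)
  have hmG : ∀ z, Meas z → Measurable (fun t => G (z.1 t) (z.2 t)) := fun z hz =>
    hGc.measurable.comp (hz.1.prodMk hz.2)
  have hbF : ∀ z, Box z → ∀ t, l1 * m1 * a1 ≤ F (z.1 t) (z.2 t) ∧
      F (z.1 t) (z.2 t) ≤ l1 * m1 * A1 := fun z hz t =>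
    hFb _ _ (hz t).1 (hz t).2.1 (hz t).2.2.1 (hz t).2.2.2
  have hbG : ∀ z, Box z → ∀ t, l2 * m2 * a2 ≤ G (z.1 t) (z.2 t) ∧
      G (z.1 t) (z.2 t) ≤ l2 * m2 * A2 := fun z hz t =>
    hGb _ _ (hz t).1 (hz t).2.1 (hz t).2.2.1 (hz t).2.2.2
  have hN : ∀ z, Meas z → Box z → (Continuous (N z).1 ∧ Continuous (N z).2) ∧ Box (N z) := by
    intro z hz hb
    have h1 := auxN_good hl1 hu0 hu0' (hmF z hz) (fun t => (hbF z hb t).1) (fun t => (hbF z hb t).2)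
    have h2 := auxN_good hl2 hv0 hv0' (hmG z hz) (fun t => (hbG z hb t).1) (fun t => (hbG z hb t).2)
    exact ⟨⟨h1.1, h2.1⟩, fun x => ⟨(h1.2 x).1, (h1.2 x).2, (h2.2 x).1, (h2.2 x).2⟩⟩
  let z : ℕ → (ℝ → ℝ) × (ℝ → ℝ) := fun n => N^[n] (fun _ => A1, fun _ => a2)
  have hz0 : z 0 = (fun _ => A1, fun _ => a2) := rfl
  have hzs : ∀ n, z (n + 1) = N (z n) := fun n => Function.iterate_succ_apply' N n _
  have hgood : ∀ n, Meas (z n) ∧ Box (z n) := by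
    intro n
    induction n with
    | zero =>
      rw [hz0]
      exact ⟨⟨measurable_const, measurable_const⟩, fun x => ⟨hu0.trans hu0', le_rfl, le_rfl,
        hv0.trans hv0'⟩⟩
    | succ n ih =>
      rw [hzs]
      have := hN _ ih.1 ih.2
      exact ⟨⟨this.1.1.measurable, this.1.2.measurable⟩, this.2⟩
  have hmonN : ∀ z z', Meas z → Meas z' → Box z → Box z' → (∀ x, z.1 x ≤ z'.1 x ∧ z'.2 x ≤ z.2 x) →
      ∀ x, (N z).1 x ≤ (N z').1 x ∧ (N z').2 x ≤ (N z).2 x := by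
    intro z z' hz hz' hb hb' hle x
    constructor
    · exact auxN_mono hl1 (hmF z hz) (hmF z' hz')
        (fun t => abs_le_max_abs_abs (hbF z hb t).1 (hbF z hb t).2)
        (fun t => abs_le_max_abs_abs (hbF z' hb' t).1 (hbF z' hb' t).2)
        (fun t => hF _ _ _ _ (hb t).1 (hle t).1 (hb' t).2.1 (hb' t).2.2.1 (hle t).2 (hb t).2.2.2) x
    · exact auxN_mono hl2 (hmG z' hz') (hmG z hz)
        (fun t => abs_le_max_abs_abs (hbG z' hb' t).1 (hbG z' hb' t).2)
        (fun t => abs_le_max_abs_abs (hbG z hb t).1 (hbG z hb t).2)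
        (fun t => hG _ _ _ _ (hb t).1 (hle t).1 (hb' t).2.1 (hb' t).2.2.1 (hle t).2 (hb t).2.2.2) x
  have hstep : ∀ n x, (z (n + 1)).1 x ≤ (z n).1 x ∧ (z n).2 x ≤ (z (n + 1)).2 x := by
    intro n
    induction n with
    | zero =>
      intro x
      have := (hgood 1).2 x
      exact ⟨this.2.1, this.2.2.1⟩
    | succ n ih =>
      intro x
      rw [hzs (n + 1)]
      nth_rewrite 2 [hzs n]
      nth_rewrite 2 [hzs n]
      exact hmonN _ _ (hgood (n + 1)).1 (hgood n).1 (hgood (n + 1)).2 (hgood n).2 ih x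
  have hlim1 : ∀ x, Tendsto (fun n => (z n).1 x) atTop (nhds (⨅ n, (z n).1 x)) := fun x =>
    tendsto_atTop_ciInf (antitone_nat_of_succ_le fun n => (hstep n x).1)
      ⟨a1, by rintro _ ⟨n, rfl⟩; exact ((hgood n).2 x).1⟩
  have hlim2 : ∀ x, Tendsto (fun n => (z n).2 x) atTop (nhds (⨆ n, (z n).2 x)) := fun x =>
    tendsto_atTop_ciSup (monotone_nat_of_le_succ fun n => (hstep n x).2)
      ⟨A2, by rintro _ ⟨n, rfl⟩; exact ((hgood n).2 x).2.2.2⟩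
  let Z : (ℝ → ℝ) × (ℝ → ℝ) := (fun x => ⨅ n, (z n).1 x, fun x => ⨆ n, (z n).2 x)
  have hlim1' : ∀ x, Tendsto (fun n => (z n).1 x) atTop (nhds (Z.1 x)) := hlim1
  have hlim2' : ∀ x, Tendsto (fun n => (z n).2 x) atTop (nhds (Z.2 x)) := hlim2
  have hZm : Meas Z :=
    ⟨measurable_of_tendsto_metrizable (fun n => (hgood n).1.1) (tendsto_pi_nhds.2 hlim1'),
     measurable_of_tendsto_metrizable (fun n => (hgood n).1.2) (tendsto_pi_nhds.2 hlim2')⟩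
  have hZb : Box Z := fun x =>
    ⟨ge_of_tendsto' (hlim1' x) fun n => ((hgood n).2 x).1,
     le_of_tendsto' (hlim1' x) fun n => ((hgood n).2 x).2.1,
     ge_of_tendsto' (hlim2' x) fun n => ((hgood n).2 x).2.2.1,
     le_of_tendsto' (hlim2' x) fun n => ((hgood n).2 x).2.2.2⟩
  have hFt : ∀ t, Tendsto (fun n => F ((z n).1 t) ((z n).2 t)) atTop (nhds (F (Z.1 t) (Z.2 t))) :=
    fun t => (hFc.tendsto (Z.1 t, Z.2 t)).comp ((hlim1' t).prodMk_nhds (hlim2' t))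
  have hGt : ∀ t, Tendsto (fun n => G ((z n).1 t) ((z n).2 t)) atTop (nhds (G (Z.1 t) (Z.2 t))) :=
    fun t => (hGc.tendsto (Z.1 t, Z.2 t)).comp ((hlim1' t).prodMk_nhds (hlim2' t))
  have hfix1 : ∀ x, Z.1 x = (N Z).1 x := fun x => by
    refine tendsto_nhds_unique ((hlim1' x).comp (tendsto_add_atTop_nat 1)) ?_
    have := auxN_tendsto (m := m1) (w0 := u0) hl1 (fun n => hmF _ (hgood n).1)
      (fun n t => (hbF _ (hgood n).2 t).1) (fun n t => (hbF _ (hgood n).2 t).2) hFt x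
    refine this.congr fun n => ?_
    show (N (z n)).1 x = (z (n + 1)).1 x
    rw [hzs]
  have hfix2 : ∀ x, Z.2 x = (N Z).2 x := fun x => by
    refine tendsto_nhds_unique ((hlim2' x).comp (tendsto_add_atTop_nat 1)) ?_
    have := auxN_tendsto (m := m2) (w0 := v0) hl2 (fun n => hmG _ (hgood n).1)
      (fun n t => (hbG _ (hgood n).2 t).1) (fun n t => (hbG _ (hgood n).2 t).2) hGt x
    refine this.congr fun n => ?_
    show (N (z n)).2 x = (z (n + 1)).2 x
    rw [hzs]
  have hZc1 : Continuous Z.1 := by rw [funext hfix1]; exact (hN Z hZm hZb).1.1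
  have hZc2 : Continuous Z.2 := by rw [funext hfix2]; exact (hN Z hZm hZb).1.2
  obtain ⟨u, p, hu00, hu, hup, hpr⟩ := auxN_sol (l := l1) (m := m1) (w0 := u0) hl1
    (f := fun t => F (Z.1 t) (Z.2 t)) (hFc.comp (hZc1.prodMk hZc2))
    (fun t => (hbF Z hZb t).1) (fun t => (hbF Z hZb t).2)
  obtain ⟨v, q, hv00, hv, hvq, hqr⟩ := auxN_sol (l := l2) (m := m2) (w0 := v0) hl2
    (f := fun t => G (Z.1 t) (Z.2 t)) (hGc.comp (hZc1.prodMk hZc2))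
    (fun t => (hbG Z hZb t).1) (fun t => (hbG Z hZb t).2)
  have hu' : ∀ x, 0 ≤ x → u x = Z.1 x := fun x hx => (hu x hx).trans (hfix1 x).symm
  have hv' : ∀ x, 0 ≤ x → v x = Z.2 x := fun x hx => (hv x hx).trans (hfix2 x).symm
  refine ⟨u, p, v, q, hu00, hv00, fun x hx => ?_, hup, fun x hx => ?_, hvq, fun x hx => ?_⟩
  · rw [hu' x hx, hv' x hx]; exact hZb x
  · have := hpr x
    simp only [← hu' x hx, ← hv' x hx] at this
    exact this
  · have := hqr x
    simp only [← hu' x hx, ← hv' x hx] at this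
    exact this

lemma aux_half_lv {a b c d s u0 v0 : ℝ} (ha : 0 < a) (hb : 0 < b) (hc : 0 < c) (hd : 0 < d)
    (hs : 0 < s) (hu0 : 0 < u0) (hu1 : u0 ≤ 1) (hu2 : u0 + c * a ≤ 1) (hv0 : 0 < v0)
    (hv1 : v0 ≤ a) (hv2 : b + v0 ≤ a) :
    ∃ u p v q : ℝ → ℝ, u 0 = u0 ∧ v 0 = v0 ∧
      (∀ x, 0 ≤ x → u0 ≤ u x ∧ u x ≤ 1 ∧ v0 ≤ v x ∧ v x ≤ a) ∧
      (∀ x, HasDerivAt u (p x) x) ∧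
      (∀ x, 0 ≤ x → HasDerivAt p (s * p x - u x * (1 - u x - c * v x)) x) ∧
      (∀ x, HasDerivAt v (q x) x) ∧
      (∀ x, 0 ≤ x → HasDerivAt q ((s * q x - v x * (a - b * u x - v x)) / d) x) := by
  obtain ⟨K1, hK1⟩ : ∃ K, K = 1 + c * a := ⟨_, rfl⟩
  obtain ⟨K2, hK2⟩ : ∃ K, K = 1 + (a + b) / d := ⟨_, rfl⟩
  have hca : 0 < c * a := by positivity
  have hK1' : 1 ≤ K1 := by linarith
  have hab : 0 < (a + b) / d := by positivity
  have hK2' : 1 ≤ K2 := by linarith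
  have hsd : 0 < s / d := by positivity
  have hβ1 : 1 + c * a ≤ (s + K1) * K1 := by nlinarith
  have hβ2 : (a + b) / d ≤ (s / d + K2) * K2 := by nlinarith
  obtain ⟨β1, hB1⟩ : ∃ K, K = (s + K1) * K1 := ⟨_, rfl⟩
  obtain ⟨β2, hB2⟩ : ∃ K, K = (s / d + K2) * K2 := ⟨_, rfl⟩
  rw [← hB1] at hβ1
  rw [← hB2] at hβ2
  have hβ2' : a + b ≤ β2 * d := by rwa [div_le_iff₀ hd] at hβ2
  have hF : ∀ u v u' v', u0 ≤ u → u ≤ u' → u' ≤ 1 → v0 ≤ v' → v' ≤ v → v ≤ a →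
      β1 * u + u * (1 - u - c * v) ≤ β1 * u' + u' * (1 - u' - c * v') := by
    intro u v u' v' h1 h2 h3 h4 h5 h6
    have e1 : 0 ≤ u' * (c * (v - v')) :=
      mul_nonneg (by linarith) (mul_nonneg hc.le (by linarith))
    have e2 : c * v ≤ c * a := mul_le_mul_of_nonneg_left h6 hc.le
    have e3 : 0 ≤ (u' - u) * (β1 + 1 - u - u' - c * v) :=
      mul_nonneg (by linarith) (by linarith)
    nlinarith
  have hG : ∀ u v u' v', u0 ≤ u → u ≤ u' → u' ≤ 1 → v0 ≤ v' → v' ≤ v → v ≤ a →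
      β2 * v' + v' * (a - b * u' - v') / d ≤ β2 * v + v * (a - b * u - v) / d := by
    intro u v u' v' h1 h2 h3 h4 h5 h6
    have e1 : 0 ≤ v' * (b * (u' - u)) :=
      mul_nonneg (by linarith) (mul_nonneg hb.le (by linarith))
    have e2 : b * u ≤ b * 1 := mul_le_mul_of_nonneg_left (h2.trans h3) hb.le
    have e3 : 0 ≤ (v - v') * (β2 * d + a - v - v' - b * u) :=
      mul_nonneg (by linarith) (by linarith)
    have e4 : β2 * d * v' + v' * (a - b * u' - v') ≤ β2 * d * v + v * (a - b * u - v) := by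
      nlinarith
    have e5 : ∀ x y : ℝ, β2 * x + y / d = (β2 * d * x + y) / d := fun x y => by field_simp
    rw [e5, e5]
    exact div_le_div_of_nonneg_right e4 hd.le
  have hcva : c * v0 ≤ c * a := mul_le_mul_of_nonneg_left hv1 hc.le
  obtain ⟨u, p, v, q, h1, h2, h3, h4, h5, h6, h7⟩ :=
    aux_half (l1 := s + K1) (m1 := K1) (l2 := s / d + K2) (m2 := K2) (a1 := u0) (A1 := 1)
      (a2 := v0) (A2 := a) (u0 := u0) (v0 := v0) (by linarith) (by linarith) le_rfl hu1 le_rfl hv1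
      (fun u v => β1 * u + u * (1 - u - c * v)) (fun u v => β2 * v + v * (a - b * u - v) / d)
      (by fun_prop) (by fun_prop) hF hG
      (fun u v g1 g2 g3 g4 => by
        have e1 := hF u0 a u v le_rfl g1 g2 g3 g4 le_rfl
        have e2 := hF u v 1 v0 g1 g2 le_rfl le_rfl g3 g4
        have e3 : 0 ≤ u0 * (1 - u0 - c * a) := mul_nonneg hu0.le (by linarith)
        have e4 : 0 < c * v0 := by positivity
        simp only [← hB1]
        constructor <;> linarith)
      (fun u v g1 g2 g3 g4 => by
        have e1 := hG u v 1 v0 g1 g2 le_rfl le_rfl g3 g4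
        have e2 := hG u0 a u v le_rfl g1 g2 g3 g4 le_rfl
        have e3 : 0 ≤ v0 * (a - b * 1 - v0) / d :=
          div_nonneg (mul_nonneg hv0.le (by linarith)) hd.le
        have e4 : a * (a - b * u0 - a) / d ≤ 0 := by
          apply div_nonpos_of_nonpos_of_nonneg _ hd.le
          have : 0 < b * u0 := by positivity
          exact mul_nonpos_of_nonneg_of_nonpos ha.le (by linarith)
        simp only [← hB2]
        constructor <;> linarith)
  refine ⟨u, p, v, q, h1, h2, h3, h4, fun x hx => ?_, h6, fun x hx => ?_⟩
  · refine (h5 x hx).congr_deriv ?_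
    rw [hB1]; ring
  · refine (h7 x hx).congr_deriv ?_
    rw [hB2]; field_simp; ring

lemma aux_ratio {u p r g : ℝ → ℝ} {d s K u0 A : ℝ} (hd : 0 < d) (hs : 0 < s) (hu0 : 0 < u0)
    (hu : ∀ t, 0 ≤ t → HasDerivAt u (p t) t) (hp : ∀ t, 0 ≤ t → HasDerivAt p (r t) t)
    (hr : ∀ t, 0 ≤ t → d * r t - s * p t = - (u t * g t))
    (hl : ∀ t, 0 ≤ t → u0 ≤ u t) (hA : ∀ t, 0 ≤ t → u t ≤ A) (hg : ∀ t, 0 ≤ t → g t ≤ K)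
    (hK : 4 * d * K ≤ s ^ 2) : ∀ t, 0 ≤ t → p t < s / (2 * d) * u t := by
  intro t ht
  by_contra hc
  push Not at hc
  obtain ⟨k, hk⟩ : ∃ k, k = s / (2 * d) := ⟨_, rfl⟩
  rw [← hk] at hc
  have hk0 : 0 < k := by rw [hk]; positivity
  have hks : s = 2 * d * k := by rw [hk]; field_simp
  have hE : ∀ t, HasDerivAt (fun t => exp (-k * t)) (exp (-k * t) * (-k)) t := fun t => by
    simpa using ((hasDerivAt_id t).const_mul (-k)).exp
  have hge : ∀ y, t ≤ y → k * u y ≤ p y := by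
    intro y hy
    have := aux_mono (f := fun x => exp (-k * x) * (p x - k * u x)) hy
      (fun x h1 _ => (hE x).mul ((hp x (ht.trans h1)).sub ((hu x (ht.trans h1)).const_mul k)))
      (fun x h1 _ => by
        have hx := ht.trans h1
        have e1 := hr x hx
        have e2 : 0 ≤ u x * (d * k ^ 2 - g x) := by
          refine mul_nonneg (hu0.le.trans (hl x hx)) ?_
          have e3 : d * K ≤ d * (d * k ^ 2) := by rw [hks] at hK; linarith
          have e4 := le_of_mul_le_mul_left e3 hd
          have := hg x hx
          linarith
        have e5 : d * (r x - k * p x - k * (p x - k * u x)) = u x * (d * k ^ 2 - g x) := by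
          rw [hks] at e1; linear_combination e1
        have e6 : 0 ≤ r x - k * p x - k * (p x - k * u x) := by
          rw [← e5] at e2; exact nonneg_of_mul_nonneg_right e2 hd
        have e7 := mul_nonneg (exp_pos (-k * x)).le e6
        linarith)
    have h1 : 0 ≤ exp (-k * t) * (p t - k * u t) := mul_nonneg (exp_pos _).le (by linarith)
    have h2 : 0 ≤ exp (-k * y) * (p y - k * u y) := h1.trans this
    have h3 := nonneg_of_mul_nonneg_right h2 (exp_pos _)
    linarith
  have hku : 0 < k * u0 := by positivity
  have hA0 : 0 ≤ A := hu0.le.trans ((hl t ht).trans (hA t ht))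
  have hty : t ≤ t + A / (k * u0) := by
    have : 0 ≤ A / (k * u0) := by positivity
    linarith
  have h1 := aux_mono (f := fun x => u x - k * u0 * x) (f' := fun x => p x - k * u0) hty
    (fun x h1 _ => by
      have := (hu x (ht.trans h1)).sub ((hasDerivAt_id x).const_mul (k * u0))
      rw [mul_one] at this
      exact this)
    (fun x h1 _ => by
      have e1 := hge x h1
      have e2 := mul_le_mul_of_nonneg_left (hl x (ht.trans h1)) hk0.le
      linarith)
  have h2 : k * u0 * (A / (k * u0)) = A := by field_simp
  have h3 := hA _ (ht.trans hty)
  have h4 := hl t ht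
  have h5 : k * u0 * (t + A / (k * u0)) = k * u0 * t + A := by rw [mul_add, h2]
  simp only [h5] at h1
  linarith

lemma aux_init {u p : ℝ → ℝ} {r0 : ℝ} (hu : ∀ t, 0 ≤ t → HasDerivAt u (p t) t)
    (hp : HasDerivAt p r0 0) (hge : ∀ t, 0 ≤ t → u 0 ≤ u t)
    (hr : p 0 = 0 → r0 < 0) : 0 < p 0 := by
  by_contra hc
  push Not at hc
  have key : ∀ᶠ y in nhdsWithin 0 (Set.Ioi 0), p y < 0 := by
    rcases hc.eq_or_lt with h | h
    · have := aux_pos_right hp.neg (by have := hr h; linarith)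
      filter_upwards [this] with y hy
      simp only [Pi.neg_apply, h] at hy
      linarith
    · exact (hp.continuousAt.eventually (gt_mem_nhds h)).filter_mono nhdsWithin_le_nhds
  rw [eventually_nhdsWithin_iff] at key
  obtain ⟨ε, hε, h2⟩ := Metric.eventually_nhds_iff.1 key
  have : StrictAntiOn u (Set.Icc 0 (ε / 2)) := by
    apply strictAntiOn_of_deriv_neg (convex_Icc 0 (ε / 2))
    · exact fun x hx => (hu x hx.1).continuousAt.continuousWithinAt
    · intro x hx
      rw [interior_Icc] at hx
      rw [(hu x hx.1.le).deriv]
      exact h2 (by rw [Real.dist_eq, abs_lt]; constructor <;> linarith [hx.1, hx.2]) hx.1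
  have h3 := this (a := 0) (b := ε / 2) ⟨le_rfl, by linarith⟩ ⟨by linarith, le_rfl⟩ (by linarith)
  have h4 := hge (ε / 2) (by linarith)
  linarith

lemma aux_lim {u p r g : ℝ → ℝ} {d s k κ : ℝ} (hd : 0 < d) (hs : 0 < s) (hk : 0 < k) (hκ : 0 < κ)
    (hu : ∀ t, t ≤ 0 → HasDerivAt u (p t) t) (hp : ∀ t, t ≤ 0 → HasDerivAt p (r t) t)
    (hr : ∀ t, t ≤ 0 → d * r t - s * p t = - (u t * g t))
    (hpos : ∀ t, t ≤ 0 → 0 < u t) (hp0 : ∀ t, t ≤ 0 → 0 < p t) (hp1 : ∀ t, t ≤ 0 → p t < k * u t)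
    (hg : ∀ t, t ≤ 0 → κ ≤ g t) : Tendsto u atBot (nhds 0) := by
  have hmono : ∀ x y, x ≤ y → y ≤ 0 → u x ≤ u y := fun x y hxy hy =>
    aux_mono hxy (fun t _ h => hu t (h.trans hy)) (fun t _ h => (hp0 t (h.trans hy)).le)
  rw [Metric.tendsto_nhds]
  intro ε hε
  obtain ⟨t, ht, hut⟩ : ∃ t, t ≤ 0 ∧ u t < ε := by
    by_contra hc
    push Not at hc
    have hm : 0 < ε * κ := by positivity
    have hu00 := hpos 0 le_rfl
    have hx : -((d * k * u 0 + s * u 0) / (ε * κ)) ≤ 0 := by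
      have : 0 ≤ (d * k * u 0 + s * u 0) / (ε * κ) := by positivity
      linarith
    have h1 := aux_int (d := -d) (s := -s) (m := ε * κ) hx (fun t _ h => hu t h)
      (fun t _ h => hp t h) (fun t _ h => by
        have e1 := hr t h
        have e2 := mul_le_mul (hc t h) (hg t h) hκ.le (hpos t h).le
        linarith)
    have h2 : ε * κ * (0 - -((d * k * u 0 + s * u 0) / (ε * κ))) = d * k * u 0 + s * u 0 := by
      field_simp; ring
    rw [h2] at h1
    have h3 : d * p (-((d * k * u 0 + s * u 0) / (ε * κ))) ≤ d * (k * u 0) := by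
      refine mul_le_mul_of_nonneg_left ?_ hd.le
      refine (hp1 _ hx).le.trans (mul_le_mul_of_nonneg_left (hmono _ _ hx le_rfl) hk.le)
    have h4 : 0 < d * p 0 := mul_pos hd (hp0 0 le_rfl)
    have h5 := mul_pos hs (hpos _ hx)
    linarith
  filter_upwards [Iic_mem_atBot t] with x hx
  rw [Real.dist_eq, sub_zero, abs_of_pos (hpos x (le_trans hx ht))]
  exact (hmono x t hx ht).trans_lt hut

lemma aux_ev_le {w q r g : ℝ → ℝ} {d s w0 A M ε : ℝ} (hd : 0 < d) (hs : 0 < s) (hw0 : 0 < w0)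
    (hw : ∀ t, 0 ≤ t → HasDerivAt w (q t) t) (hq : ∀ t, 0 ≤ t → HasDerivAt q (r t) t)
    (hr : ∀ t, 0 ≤ t → d * r t - s * q t = - (w t * (g t - w t)))
    (hl : ∀ t, 0 ≤ t → w0 ≤ w t) (hA : ∀ t, 0 ≤ t → w t ≤ A)
    (hg : ∀ᶠ t in atTop, g t ≤ M) (hε : 0 < ε) : ∀ᶠ t in atTop, w t ≤ M + ε := by
  obtain ⟨X, hX⟩ := eventually_atTop.1 hg
  have hx : ∀ t, max X 0 ≤ t → 0 ≤ t := fun t ht => (le_max_right _ _).trans ht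
  obtain ⟨Y, _, hY⟩ := aux_trap (X := max X 0) (B := A) (θ := M + ε) (m := w0 * ε) hd hs
    (by positivity)
    (fun t ht => hw t (hx t ht)) (fun t ht => hq t (hx t ht))
    (fun t ht => by
      have h1 := hl t (hx t ht)
      rw [abs_of_pos (by linarith)]; exact hA t (hx t ht))
    (fun t ht hθ => by
      have h1 := hl t (hx t ht)
      have h2 := hX t ((le_max_left _ _).trans ht)
      have h3 := hr t (hx t ht)
      have h4 : w0 * ε ≤ w t * (w t - g t) :=
        mul_le_mul h1 (by linarith) hε.le (by linarith)
      linarith)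
  exact eventually_atTop.2 ⟨Y, hY⟩

lemma aux_ev_ge {w q r g : ℝ → ℝ} {d s w0 A M ε : ℝ} (hd : 0 < d) (hs : 0 < s) (hw0 : 0 < w0)
    (hw : ∀ t, 0 ≤ t → HasDerivAt w (q t) t) (hq : ∀ t, 0 ≤ t → HasDerivAt q (r t) t)
    (hr : ∀ t, 0 ≤ t → d * r t - s * q t = - (w t * (g t - w t)))
    (hl : ∀ t, 0 ≤ t → w0 ≤ w t) (hA : ∀ t, 0 ≤ t → w t ≤ A)
    (hg : ∀ᶠ t in atTop, M ≤ g t) (hε : 0 < ε) : ∀ᶠ t in atTop, M - ε ≤ w t := by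
  obtain ⟨X, hX⟩ := eventually_atTop.1 hg
  have hx : ∀ t, max X 0 ≤ t → 0 ≤ t := fun t ht => (le_max_right _ _).trans ht
  obtain ⟨Y, _, hY⟩ := aux_trap (X := max X 0) (B := A) (θ := -(M - ε)) (m := w0 * ε)
    (z := fun t => - w t) (p := fun t => - q t) (r := fun t => - r t) hd hs
    (by positivity)
    (fun t ht => (hw t (hx t ht)).neg) (fun t ht => (hq t (hx t ht)).neg)
    (fun t ht => by
      have h1 := hl t (hx t ht)
      rw [abs_neg, abs_of_pos (by linarith)]; exact hA t (hx t ht))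
    (fun t ht hθ => by
      have h1 := hl t (hx t ht)
      have h2 := hX t ((le_max_left _ _).trans ht)
      have h3 := hr t (hx t ht)
      have h4 : w0 * ε ≤ w t * (g t - w t) :=
        mul_le_mul h1 (by linarith) hε.le (by linarith)
      linarith)
  exact eventually_atTop.2 ⟨Y, fun t ht => by have := hY t ht; linarith⟩

lemma aux_iter {P : ℝ → Prop} {θ e0 : ℝ} (h0 : 0 ≤ θ) (hθ : θ < 1) (he0 : 0 < e0) (hP : P e0)
    (hup : ∀ e e', e ≤ e' → P e → P e') (hstep : ∀ e, 0 < e → P e → P (θ * e)) :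
    ∀ e, 0 < e → P e := by
  intro e he
  rcases h0.eq_or_lt with h0 | h0
  · have := hstep e0 he0 hP
    rw [← h0, zero_mul] at this
    exact hup _ _ he.le this
  have h1 : ∀ n : ℕ, 0 < θ ^ n * e0 ∧ P (θ ^ n * e0) := by
    intro n
    induction n with
    | zero => simpa using ⟨he0, hP⟩
    | succ n ih =>
      have := hstep _ ih.1 ih.2
      rw [pow_succ', mul_assoc]
      exact ⟨mul_pos h0 ih.1, this⟩
  obtain ⟨n, hn⟩ := exists_pow_lt_of_lt_one (div_pos he he0) hθ
  rw [lt_div_iff₀ he0] at hn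
  exact hup _ _ hn.le (h1 n).2

lemma aux_conv {u p r v q r' : ℝ → ℝ} {a b c d s u0 v0 U V : ℝ} (hb : 0 < b) (hc : 0 < c)
    (hd : 0 < d) (hs : 0 < s) (hu0 : 0 < u0) (hv0 : 0 < v0) (hbc : b * c < 1)
    (hU : U = 1 - c * V) (hV : V = a - b * U)
    (hu : ∀ t, 0 ≤ t → HasDerivAt u (p t) t) (hp : ∀ t, 0 ≤ t → HasDerivAt p (r t) t)
    (hv : ∀ t, 0 ≤ t → HasDerivAt v (q t) t) (hq : ∀ t, 0 ≤ t → HasDerivAt q (r' t) t)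
    (hr : ∀ t, 0 ≤ t → 1 * r t - s * p t = - (u t * ((1 - c * v t) - u t)))
    (hr' : ∀ t, 0 ≤ t → d * r' t - s * q t = - (v t * ((a - b * u t) - v t)))
    (hbd : ∀ x, 0 ≤ x → u0 ≤ u x ∧ u x ≤ 1 ∧ v0 ≤ v x ∧ v x ≤ a) :
    Tendsto u atTop (nhds U) ∧ Tendsto v atTop (nhds V) := by
  have hbc0 : 0 < b * c := by positivity
  have ul := fun t ht => (hbd t ht).1
  have uu := fun t ht => (hbd t ht).2.1
  have vl := fun t ht => (hbd t ht).2.2.1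
  have vu := fun t ht => (hbd t ht).2.2.2
  have s1 : ∀ e ε, 0 < ε → (∀ᶠ t in atTop, u t ≤ U + e) →
      ∀ᶠ t in atTop, V - b * e - ε ≤ v t := fun e ε hε h =>
    aux_ev_ge hd hs hv0 hv hq hr' vl vu (by
      filter_upwards [h] with t ht
      have := mul_le_mul_of_nonneg_left ht hb.le
      linarith) hε
  have s2 : ∀ e ε, 0 < ε → (∀ᶠ t in atTop, U - e ≤ u t) →
      ∀ᶠ t in atTop, v t ≤ V + b * e + ε := fun e ε hε h =>
    aux_ev_le hd hs hv0 hv hq hr' vl vu (by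
      filter_upwards [h] with t ht
      have := mul_le_mul_of_nonneg_left ht hb.le
      linarith) hε
  have s3 : ∀ e ε, 0 < ε → (∀ᶠ t in atTop, v t ≤ V + e) →
      ∀ᶠ t in atTop, U - c * e - ε ≤ u t := fun e ε hε h =>
    aux_ev_ge one_pos hs hu0 hu hp hr ul uu (by
      filter_upwards [h] with t ht
      have := mul_le_mul_of_nonneg_left ht hc.le
      linarith) hε
  have s4 : ∀ e ε, 0 < ε → (∀ᶠ t in atTop, V - e ≤ v t) →
      ∀ᶠ t in atTop, u t ≤ U + c * e + ε := fun e ε hε h =>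
    aux_ev_le one_pos hs hu0 hu hp hr ul uu (by
      filter_upwards [h] with t ht
      have := mul_le_mul_of_nonneg_left ht hc.le
      linarith) hε
  have huge : ∀ e, 0 < e → ∀ᶠ t in atTop, u t ≤ U + e := by
    refine aux_iter (θ := (1 + b * c) / 2) (e0 := 1 + |U|) (by linarith) (by linarith)
      (by positivity) ?_ ?_ ?_
    · filter_upwards [eventually_ge_atTop 0] with t ht
      have := neg_abs_le U
      linarith [uu t ht]
    · intro e e' hee h
      filter_upwards [h] with t ht
      linarith
    · intro e he h
      have hη : 0 < (1 - b * c) * e / 4 := by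
        have : 0 < 1 - b * c := by linarith
        positivity
      have h1 := s1 e ((1 - b * c) * e / 4 / c) (by positivity) h
      have h2 := s4 (b * e + (1 - b * c) * e / 4 / c) ((1 - b * c) * e / 4) hη (by
        filter_upwards [h1] with t ht
        linarith)
      filter_upwards [h2] with t ht
      have : c * ((1 - b * c) * e / 4 / c) = (1 - b * c) * e / 4 := by field_simp
      rw [mul_add, this] at ht
      linarith
  have hlge : ∀ e, 0 < e → ∀ᶠ t in atTop, U - e ≤ u t := by
    refine aux_iter (θ := (1 + b * c) / 2) (e0 := 1 + |U|) (by linarith) (by linarith)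
      (by positivity) ?_ ?_ ?_
    · filter_upwards [eventually_ge_atTop 0] with t ht
      have := le_abs_self U
      linarith [ul t ht]
    · intro e e' hee h
      filter_upwards [h] with t ht
      linarith
    · intro e he h
      have hη : 0 < (1 - b * c) * e / 4 := by
        have : 0 < 1 - b * c := by linarith
        positivity
      have h1 := s2 e ((1 - b * c) * e / 4 / c) (by positivity) h
      have h2 := s3 (b * e + (1 - b * c) * e / 4 / c) ((1 - b * c) * e / 4) hη (by
        filter_upwards [h1] with t ht
        linarith)
      filter_upwards [h2] with t ht
      have : c * ((1 - b * c) * e / 4 / c) = (1 - b * c) * e / 4 := by field_simp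
      rw [mul_add, this] at ht
      linarith
  constructor
  · rw [Metric.tendsto_nhds]
    intro ε hε
    filter_upwards [huge (ε / 2) (by linarith), hlge (ε / 2) (by linarith)] with t h1 h2
    rw [Real.dist_eq, abs_lt]
    constructor <;> linarith
  · rw [Metric.tendsto_nhds]
    intro ε hε
    have e1 : b * (ε / 4 / b) = ε / 4 := by field_simp
    have h1 := s1 (ε / 4 / b) (ε / 4) (by positivity) (huge _ (by positivity))
    have h2 := s2 (ε / 4 / b) (ε / 4) (by positivity) (hlge _ (by positivity))
    rw [e1] at h1 h2
    filter_upwards [h1, h2] with t h1 h2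
    rw [Real.dist_eq, abs_lt]
    constructor <;> linarith

lemma aux_backward {a b c d s u0 p0 v0 q0 : ℝ} (hb : 0 < b) (hc : 0 < c) (hd : 0 < d)
    (hs : 0 < s) (hs1 : 4 ≤ s ^ 2) (hs2 : 4 * d * a ≤ s ^ 2) (hu0 : 0 < u0) (hv0 : 0 < v0)
    (h1 : u0 + c * v0 < 1) (h2 : b * u0 + v0 < a) (hp0 : 0 < p0) (hp1 : p0 < s / 2 * u0)
    (hq0 : 0 < q0) (hq1 : q0 < s / (2 * d) * v0) :
    ∃ u p v q : ℝ → ℝ, u 0 = u0 ∧ p 0 = p0 ∧ v 0 = v0 ∧ q 0 = q0 ∧ ∀ t, t ≤ 0 →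
      HasDerivAt u (p t) t ∧ HasDerivAt p (s * p t - u t * (1 - u t - c * v t)) t ∧
      HasDerivAt v (q t) t ∧ HasDerivAt q ((s * q t - v t * (a - b * u t - v t)) / d) t ∧
      0 < p t ∧ p t < s / 2 * u t ∧ 0 < q t ∧ q t < s / (2 * d) * v t ∧
      u t ≤ u0 ∧ v t ≤ v0 := by
  obtain ⟨k1, hk1⟩ : ∃ k, k = s / 2 := ⟨_, rfl⟩
  obtain ⟨k2, hk2⟩ : ∃ k, k = s / (2 * d) := ⟨_, rfl⟩
  have hk10 : 0 < k1 := by rw [hk1]; positivity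
  have hk20 : 0 < k2 := by rw [hk2]; positivity
  have hks1 : s = 2 * k1 := by rw [hk1]; ring
  have hks2 : s = 2 * d * k2 := by rw [hk2]; field_simp
  rw [← hk1] at hp1 ⊢
  rw [← hk2] at hq1 ⊢
  have hR1 : 0 < k1 * u0 := by positivity
  have hR2 : 0 < k2 * v0 := by positivity
  obtain ⟨R, hR⟩ : ∃ R, R = u0 + v0 + k1 * u0 + k2 * v0 := ⟨_, rfl⟩
  obtain ⟨u, p, v, q, hi, u', p', v', q', hu, hp, hv, hq, hu', hv', hbox⟩ := aux_clamp_exists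
    (fun x => (x.2.1, s * x.2.1 - x.1 * (1 - x.1 - c * x.2.2.1), x.2.2.2,
      (s * x.2.2.2 - x.2.2.1 * (a - b * x.1 - x.2.2.1)) / d)) (by fun_prop) R (by linarith)
      (fun x hx => hx) (fun x hx => hx) (u0, p0, v0, q0)
  simp only [Prod.mk.injEq] at hi hbox
  obtain ⟨iu, ip, iv, iq⟩ := hi
  have hule : ∀ t, t ≤ 0 → u t ≤ u0 := fun t ht => by
    rw [← iu]; exact aux_mono ht (fun x _ _ => hu x) (fun x _ _ => hu' x)
  have hvle : ∀ t, t ≤ 0 → v t ≤ v0 := fun t ht => by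
    rw [← iv]; exact aux_mono ht (fun x _ _ => hv x) (fun x _ _ => hv' x)
  -- equations hold where the four inequalities hold
  have heq : ∀ t, t ≤ 0 → 0 ≤ p t → 0 ≤ k1 * u t - p t → 0 ≤ q t → 0 ≤ k2 * v t - q t →
      u' t = p t ∧ p' t = s * p t - u t * (1 - u t - c * v t) ∧ v' t = q t ∧
        q' t = (s * q t - v t * (a - b * u t - v t)) / d := by
    intro t ht g1 g2 g3 g4
    have e1 : 0 ≤ k1 * u t := by linarith
    have e2 := nonneg_of_mul_nonneg_right e1 hk10
    have e3 : 0 ≤ k2 * v t := by linarith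
    have e4 := nonneg_of_mul_nonneg_right e3 hk20
    have e5 := hule t ht
    have e6 := hvle t ht
    have e7 := mul_le_mul_of_nonneg_left e5 hk10.le
    have e8 := mul_le_mul_of_nonneg_left e6 hk20.le
    exact hbox t e2 (by linarith) g1 (by linarith) e4 (by linarith) g3 (by linarith)
  have hEx : ∀ k t : ℝ, HasDerivAt (fun t => exp (-k * t)) (exp (-k * t) * (-k)) t := fun k t => by
    simpa using ((hasDerivAt_id t).const_mul (-k)).exp
  have hposgen : ∀ (k : ℝ) (w w' : ℝ → ℝ) (t : ℝ), t ≤ 0 → (∀ x, HasDerivAt w (w' x) x) →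
      (∀ x, t ≤ x → x ≤ 0 → w' x ≤ k * w x) → 0 < w 0 → 0 < w t := by
    intro k w w' t ht hw hle hw0
    have := aux_anti (f := fun x => exp (-k * x) * w x) ht (fun x _ _ => (hEx k x).mul (hw x))
      (fun x g1 g2 => by
        have := mul_nonneg (exp_pos (-k * x)).le (sub_nonneg.2 (hle x g1 g2))
        linarith)
    simp only [mul_zero, exp_zero, one_mul] at this
    exact (mul_pos_iff_of_pos_left (exp_pos _)).1 (hw0.trans_le this)
  have hmain := aux_back (ι := Fin 4)
    (h := ![p, fun t => k1 * u t - p t, q, fun t => k2 * v t - q t])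
    (h' := ![p', fun t => k1 * u' t - p' t, q', fun t => k2 * v' t - q' t])
    (by
      intro i t
      fin_cases i
      · exact hp t
      · exact ((hu t).const_mul k1).sub (hp t)
      · exact hq t
      · exact ((hv t).const_mul k2).sub (hq t))
    (by
      intro i
      fin_cases i
      · show 0 < p 0
        rw [ip]; exact hp0
      · show 0 < k1 * u 0 - p 0
        rw [iu, ip]; linarith
      · show 0 < q 0
        rw [iq]; exact hq0
      · show 0 < k2 * v 0 - q 0
        rw [iv, iq]; linarith)
    (by
      intro t ht hall i hi
      have g1 : ∀ x, t ≤ x → x ≤ 0 → 0 ≤ p x := hall 0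
      have g2 : ∀ x, t ≤ x → x ≤ 0 → 0 ≤ k1 * u x - p x := hall 1
      have g3 : ∀ x, t ≤ x → x ≤ 0 → 0 ≤ q x := hall 2
      have g4 : ∀ x, t ≤ x → x ≤ 0 → 0 ≤ k2 * v x - q x := hall 3
      have hE : ∀ x, t ≤ x → x ≤ 0 → _ := fun x e1 e2 =>
        heq x e2 (g1 x e1 e2) (g2 x e1 e2) (g3 x e1 e2) (g4 x e1 e2)
      have hut : 0 < u t := hposgen k1 u u' t ht hu (fun x e1 e2 => by
        rw [(hE x e1 e2).1]; linarith [g2 x e1 e2]) (by rw [iu]; exact hu0)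
      have hvt : 0 < v t := hposgen k2 v v' t ht hv (fun x e1 e2 => by
        rw [(hE x e1 e2).2.2.1]; linarith [g4 x e1 e2]) (by rw [iv]; exact hv0)
      obtain ⟨E1, E2, E3, E4⟩ := hE t le_rfl ht
      have f1 := hule t ht
      have f2 := hvle t ht
      have f3 := mul_le_mul_of_nonneg_left f1 hb.le
      have f4 := mul_le_mul_of_nonneg_left f2 hc.le
      have f5 : 0 < u t * (1 - u t - c * v t) := mul_pos hut (by linarith)
      have f6 : 0 < v t * (a - b * u t - v t) := mul_pos hvt (by linarith)
      fin_cases i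
      · have hi' : p t = 0 := hi
        show p' t < 0
        rw [E2, hi']; linarith
      · have hi' : k1 * u t - p t = 0 := hi
        show k1 * u' t - p' t < 0
        have hpk : p t = k1 * u t := by linarith
        rw [E2, E1, hpk, hks1]
        have e1 : 0 ≤ u t * (k1 ^ 2 - 1) := mul_nonneg hut.le (by rw [hks1] at hs1; linarith)
        have e2 : 0 < u t * (u t + c * v t) := by positivity
        linarith
      · have hi' : q t = 0 := hi
        show q' t < 0
        rw [E4, hi']
        exact div_neg_of_neg_of_pos (by linarith) hd
      · have hi' : k2 * v t - q t = 0 := hi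
        show k2 * v' t - q' t < 0
        have hpk : q t = k2 * v t := by linarith
        rw [E4, E3, hpk, sub_neg, lt_div_iff₀ hd, hks2]
        have e0 : d * a ≤ d * (d * k2 ^ 2) := by rw [hks2] at hs2; linarith
        have e1 : 0 ≤ v t * (d * k2 ^ 2 - a) :=
          mul_nonneg hvt.le (by linarith [le_of_mul_le_mul_left e0 hd])
        have e2 : 0 < v t * (b * u t + v t) := by positivity
        linarith)
  refine ⟨u, p, v, q, iu, ip, iv, iq, fun t ht => ?_⟩
  have g1 : 0 < p t := hmain t ht 0
  have g2 : 0 < k1 * u t - p t := hmain t ht 1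
  have g3 : 0 < q t := hmain t ht 2
  have g4 : 0 < k2 * v t - q t := hmain t ht 3
  obtain ⟨E1, E2, E3, E4⟩ := heq t ht g1.le g2.le g3.le g4.le
  exact ⟨E1 ▸ hu t, E2 ▸ hp t, E3 ▸ hv t, E4 ▸ hq t, g1, by linarith, g3, by linarith,
    hule t ht, hvle t ht⟩

lemma aux_contDiff {u p r : ℝ → ℝ} (hu : ∀ t, HasDerivAt u (p t) t)
    (hp : ∀ t, HasDerivAt p (r t) t) (hr : Continuous r) : ContDiff ℝ 2 u := by
  have hu' : deriv u = p := funext fun t => (hu t).deriv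
  have hp' : deriv p = r := funext fun t => (hp t).deriv
  rw [show (2 : WithTop ℕ∞) = 1 + 1 by norm_num, contDiff_succ_iff_deriv]
  refine ⟨fun t => (hu t).differentiableAt, by simp, ?_⟩
  rw [hu', contDiff_one_iff_deriv, hp']
  exact ⟨fun t => (hp t).differentiableAt, hr⟩

/-- existence of a wave through prescribed small data at `0` -/
lemma aux_wave {a b c d s u0 v0 : ℝ} (ha : 0 < a) (hb : 0 < b) (hc : 0 < c) (hd : 0 < d)
    (hs : 0 < s) (hs1 : 4 ≤ s ^ 2) (hs2 : 4 * d * a ≤ s ^ 2) (hba : b < a) (hac : a * c < 1)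
    (hu0 : 0 < u0) (hu2 : u0 + c * a < 1) (hv0 : 0 < v0) (hv2 : b + v0 < a) :
    ∃ u p v q : ℝ → ℝ, u 0 = u0 ∧ v 0 = v0 ∧
      (∀ t, HasDerivAt u (p t) t) ∧
      (∀ t, HasDerivAt p (s * p t - u t * (1 - u t - c * v t)) t) ∧
      (∀ t, HasDerivAt v (q t) t) ∧
      (∀ t, HasDerivAt q ((s * q t - v t * (a - b * u t - v t)) / d) t) ∧
      (∀ t, 0 < u t) ∧ (∀ t, 0 < v t) ∧ (∀ t, 0 ≤ t → v0 ≤ v t) ∧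
      (∀ t, 0 ≤ t → p t < s / 2 * u t) ∧ (∀ t, 0 ≤ t → q t < s / (2 * d) * v t) ∧
      Tendsto u atBot (nhds 0) ∧ Tendsto v atBot (nhds 0) ∧
      Tendsto u atTop (nhds ((1 - a * c) / (1 - b * c))) ∧
      Tendsto v atTop (nhds ((a - b) / (1 - b * c))) := by
  have hca : 0 < c * a := by positivity
  have hbc : b * c < 1 := (mul_lt_mul_of_pos_right hba hc).trans hac
  have hu1 : u0 ≤ 1 := by linarith
  have hv1 : v0 ≤ a := by linarith
  obtain ⟨u, p, v, q, iu, iv, hbd, hu, hp, hv, hq⟩ :=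
    aux_half_lv ha hb hc hd hs hu0 hu1 hu2.le hv0 hv1 hv2.le
  have hr : ∀ t, 0 ≤ t → 1 * (s * p t - u t * (1 - u t - c * v t)) - s * p t
      = - (u t * ((1 - c * v t) - u t)) := fun t _ => by ring
  have hr' : ∀ t, 0 ≤ t → d * ((s * q t - v t * (a - b * u t - v t)) / d) - s * q t
      = - (v t * ((a - b * u t) - v t)) := fun t _ => by field_simp; ring
  have hpu : ∀ t, 0 ≤ t → p t < s / 2 * u t := by
    have := aux_ratio (K := 1) one_pos hs hu0 (fun t _ => hu t) hp hr (fun t ht => (hbd t ht).1)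
      (fun t ht => (hbd t ht).2.1) (fun t ht => by
        have h1 := hbd t ht
        have h2 : 0 < c * v t := mul_pos hc (by linarith)
        linarith) (by linarith)
    simpa using this
  have hqv : ∀ t, 0 ≤ t → q t < s / (2 * d) * v t :=
    aux_ratio (K := a) hd hs hv0 (fun t _ => hv t) hq hr' (fun t ht => (hbd t ht).2.2.1)
      (fun t ht => (hbd t ht).2.2.2) (fun t ht => by
        have h1 := hbd t ht
        have h2 : 0 < b * u t := mul_pos hb (by linarith)
        linarith) hs2
  have hcv0 : c * v0 ≤ c * a := mul_le_mul_of_nonneg_left hv1 hc.le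
  have hbu0 : b * u0 ≤ b * 1 := mul_le_mul_of_nonneg_left hu1 hb.le
  have hk1 : u0 + c * v0 < 1 := by linarith
  have hk2 : b * u0 + v0 < a := by linarith
  have hp00 : 0 < p 0 := aux_init (fun t _ => hu t) (hp 0 le_rfl)
    (fun t ht => by rw [iu]; exact (hbd t ht).1) (fun h => by
      rw [h, iu, iv]
      have : 0 < u0 * (1 - u0 - c * v0) := mul_pos hu0 (by linarith)
      linarith)
  have hq00 : 0 < q 0 := aux_init (fun t _ => hv t) (hq 0 le_rfl)
    (fun t ht => by rw [iv]; exact (hbd t ht).2.2.1) (fun h => by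
      rw [h, iu, iv]
      have : 0 < v0 * (a - b * u0 - v0) := mul_pos hv0 (by linarith)
      exact div_neg_of_neg_of_pos (by linarith) hd)
  obtain ⟨y, yp, z, zq, j1, j2, j3, j4, hback⟩ := aux_backward (p0 := p 0) (q0 := q 0) hb hc hd hs
    hs1 hs2 hu0 hv0 hk1 hk2 hp00 (by have := hpu 0 le_rfl; rwa [iu] at this) hq00
    (by have := hqv 0 le_rfl; rwa [iv] at this)
  have hypos : ∀ t, t ≤ 0 → 0 < y t := fun t ht => by
    obtain ⟨_, _, _, _, h5, h6, _⟩ := hback t ht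
    exact (mul_pos_iff_of_pos_left (by positivity : 0 < s / 2)).1 (h5.trans h6)
  have hzpos : ∀ t, t ≤ 0 → 0 < z t := fun t ht => by
    obtain ⟨_, _, _, _, _, _, h5, h6, _⟩ := hback t ht
    exact (mul_pos_iff_of_pos_left (by positivity : 0 < s / (2 * d))).1 (h5.trans h6)
  have hyr : ∀ t, t ≤ 0 → 1 * (s * yp t - y t * (1 - y t - c * z t)) - s * yp t
      = - (y t * (1 - y t - c * z t)) := fun t _ => by ring
  have hzr : ∀ t, t ≤ 0 → d * ((s * zq t - z t * (a - b * y t - z t)) / d) - s * zq t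
      = - (z t * (a - b * y t - z t)) := fun t _ => by field_simp; ring
  have hylim : Tendsto y atBot (nhds 0) :=
    aux_lim (k := s / 2) (κ := 1 - u0 - c * v0) one_pos hs (by positivity) (by linarith)
      (fun t ht => (hback t ht).1) (fun t ht => (hback t ht).2.1) hyr hypos
      (fun t ht => (hback t ht).2.2.2.2.1) (fun t ht => (hback t ht).2.2.2.2.2.1)
      (fun t ht => by
        obtain ⟨_, _, _, _, _, _, _, _, h1, h2⟩ := hback t ht
        have := mul_le_mul_of_nonneg_left h2 hc.le
        linarith)
  have hzlim : Tendsto z atBot (nhds 0) :=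
    aux_lim (k := s / (2 * d)) (κ := a - b * u0 - v0) hd hs (by positivity) (by linarith)
      (fun t ht => (hback t ht).2.2.1) (fun t ht => (hback t ht).2.2.2.1) hzr hzpos
      (fun t ht => (hback t ht).2.2.2.2.2.2.1) (fun t ht => (hback t ht).2.2.2.2.2.2.2.1)
      (fun t ht => by
        obtain ⟨_, _, _, _, _, _, _, _, h1, h2⟩ := hback t ht
        have := mul_le_mul_of_nonneg_left h1 hb.le
        linarith)
  have hbc1 : 1 - b * c ≠ 0 := ne_of_gt (by linarith)
  have hconv := aux_conv (U := (1 - a * c) / (1 - b * c)) (V := (a - b) / (1 - b * c)) hb hc hd hs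
    hu0 hv0 hbc (by rw [div_eq_iff hbc1, sub_mul, mul_assoc, div_mul_cancel₀ _ hbc1]; ring)
    (by rw [div_eq_iff hbc1, sub_mul, mul_assoc, div_mul_cancel₀ _ hbc1]; ring) (fun t _ => hu t) hp (fun t _ => hv t)
    hq hr hr' hbd
  have key : ∀ f g : ℝ → ℝ, ∀ t, 0 ≤ t → (if 0 ≤ t then f t else g t) = f t :=
    fun f g t ht => if_pos ht
  have key' : ∀ f g : ℝ → ℝ, ∀ t, ¬ 0 ≤ t → (if 0 ≤ t then f t else g t) = g t :=
    fun f g t ht => if_neg ht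
  refine ⟨fun t => if 0 ≤ t then u t else y t, fun t => if 0 ≤ t then p t else yp t,
    fun t => if 0 ≤ t then v t else z t, fun t => if 0 ≤ t then q t else zq t,
    by simp [iu], by simp [iv], ?_, ?_, ?_, ?_, ?_, ?_, ?_, ?_, ?_, ?_, ?_, ?_, ?_⟩
  · exact aux_glue (fun t _ => hu t) (fun t ht => (hback t ht).1) (by rw [iu, j1]) (by rw [j2])
  · intro t
    have := aux_glue hp (fun t ht => (hback t ht).2.1) (by rw [j2])
      (by rw [iu, iv, j1, j2, j3]) t
    refine this.congr_deriv ?_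
    by_cases ht : 0 ≤ t
    · simp only [if_pos ht]
    · simp only [if_neg ht]
  · exact aux_glue (fun t _ => hv t) (fun t ht => (hback t ht).2.2.1) (by rw [iv, j3]) (by rw [j4])
  · intro t
    have := aux_glue hq (fun t ht => (hback t ht).2.2.2.1) (by rw [j4])
      (by rw [iu, iv, j1, j3, j4]) t
    refine this.congr_deriv ?_
    by_cases ht : 0 ≤ t
    · simp only [if_pos ht]
    · simp only [if_neg ht]
  · intro t
    by_cases ht : 0 ≤ t
    · simp only [if_pos ht]; linarith [hbd t ht]
    · simp only [if_neg ht]; exact hypos t (not_le.1 ht).le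
  · intro t
    by_cases ht : 0 ≤ t
    · simp only [if_pos ht]; linarith [hbd t ht]
    · simp only [if_neg ht]; exact hzpos t (not_le.1 ht).le
  · intro t ht
    simp only [if_pos ht]; exact (hbd t ht).2.2.1
  · intro t ht
    simp only [if_pos ht]; exact hpu t ht
  · intro t ht
    simp only [if_pos ht]; exact hqv t ht
  · refine hylim.congr' ?_
    filter_upwards [Iio_mem_atBot 0] with t ht
    rw [if_neg (not_le.2 ht)]
  · refine hzlim.congr' ?_
    filter_upwards [Iio_mem_atBot 0] with t ht
    rw [if_neg (not_le.2 ht)]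
  · refine hconv.1.congr' ?_
    filter_upwards [eventually_ge_atTop 0] with t ht
    rw [if_pos ht]
  · refine hconv.2.congr' ?_
    filter_upwards [eventually_ge_atTop 0] with t ht
    rw [if_pos ht]

/-- Sufficient condition for non-monotone waves in the `v`-component: for any
`d > 0`, `a < 1/c`, and `s ≥ s*`, there is `δ = δ(a,c,s) ∈ (0, a)` such that for
every `b ∈ (δ, a)` there exists a traveling wave whose `v`-profile is
non-monotone. -/
theorem v_nonmonotone_wave
    (a c d : ℝ) (hd : 0 < d) (ha : 0 < a) (hc : 0 < c) (hac : a < 1 / c)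
    (s : ℝ) (hs : max 2 (2 * Real.sqrt (a * d)) ≤ s) :
    ∃ δ : ℝ, 0 < δ ∧ δ < a ∧
      ∀ b : ℝ, δ < b → b < a →
        ∃ u v : ℝ → ℝ, ContDiff ℝ 2 u ∧ ContDiff ℝ 2 v ∧
          (∀ ξ : ℝ, 0 < u ξ) ∧ (∀ ξ : ℝ, 0 < v ξ) ∧
          (∀ ξ : ℝ, deriv (deriv u) ξ - s * deriv u ξ + u ξ * (1 - u ξ - c * v ξ) = 0) ∧
          (∀ ξ : ℝ, d * deriv (deriv v) ξ - s * deriv v ξ + v ξ * (a - b * u ξ - v ξ) = 0) ∧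
          Tendsto u atBot (nhds 0) ∧ Tendsto v atBot (nhds 0) ∧
          Tendsto u atTop (nhds ((1 - a * c) / (1 - b * c))) ∧
          Tendsto v atTop (nhds ((a - b) / (1 - b * c))) ∧
          ¬ Monotone v ∧ ¬ Antitone v := by

  have hs2 : 2 ≤ s := (le_max_left _ _).trans hs
  have hs0 : 0 < s := by linarith
  have hsq : 2 * Real.sqrt (a * d) ≤ s := (le_max_right _ _).trans hs
  have hs4 : 4 ≤ s ^ 2 := by nlinarith
  have hs5 : 4 * d * a ≤ s ^ 2 := by
    have h1 := Real.sq_sqrt (by positivity : 0 ≤ a * d)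
    have h2 := pow_le_pow_left₀ (by positivity) hsq 2
    rw [mul_pow, h1] at h2
    linarith
  have hac' : a * c < 1 := by rwa [lt_div_iff₀ hc] at hac
  refine ⟨a / 2, by linarith, by linarith, fun b hb1 hba => ?_⟩
  have hb : 0 < b := by linarith
  have hbc : b * c < 1 := (mul_lt_mul_of_pos_right hba hc).trans hac'
  obtain ⟨V, hV⟩ : ∃ V, V = (a - b) / (1 - b * c) := ⟨_, rfl⟩
  have hV0 : 0 < V := by rw [hV]; exact div_pos (by linarith) (by linarith)
  have hVa : V < a := by
    rw [hV, div_lt_iff₀ (by linarith)]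
    have := mul_lt_mul_of_pos_left hac' hb
    linarith
  obtain ⟨v0, hv0⟩ : ∃ v, v = (a - b) / 2 := ⟨_, rfl⟩
  have hv00 : 0 < v0 := by rw [hv0]; linarith
  obtain ⟨m, hm⟩ : ∃ m, m = v0 * ((a - V) / 2) := ⟨_, rfl⟩
  have hm0 : 0 < m := by rw [hm]; exact mul_pos hv00 (by linarith)
  obtain ⟨L, hL⟩ : ∃ L, L = (s * v0 + s * V + 1) / m := ⟨_, rfl⟩
  have hL0 : 0 < L := by rw [hL]; positivity
  have hmL : m * L = s * v0 + s * V + 1 := by rw [hL]; field_simp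
  have hw0 : 0 < (a - V) / 2 / b := div_pos (by linarith) hb
  obtain ⟨u0, hu0⟩ : ∃ u, u = min ((1 - a * c) / 2) ((a - V) / 2 / b * exp (-(s / 2) * L)) :=
    ⟨_, rfl⟩
  have hu00 : 0 < u0 := by
    rw [hu0]; exact lt_min (by linarith) (mul_pos hw0 (exp_pos _))
  have hu01 : u0 ≤ (1 - a * c) / 2 := by rw [hu0]; exact min_le_left _ _
  have hu02 : u0 ≤ (a - V) / 2 / b * exp (-(s / 2) * L) := by rw [hu0]; exact min_le_right _ _
  obtain ⟨u, p, v, q, iu, iv, hu, hp, hv, hq, hup, hvp, hvl, hpu, hqv, l1, l2, l3, l4⟩ :=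
    aux_wave ha hb hc hd hs0 hs4 hs5 hba hac' hu00 (by linarith) hv00 (by linarith)
  have hdu : deriv u = p := funext fun t => (hu t).deriv
  have hdv : deriv v = q := funext fun t => (hv t).deriv
  have cu : Continuous u := continuous_iff_continuousAt.2 fun t => (hu t).continuousAt
  have cv : Continuous v := continuous_iff_continuousAt.2 fun t => (hv t).continuousAt
  have cp : Continuous p := continuous_iff_continuousAt.2 fun t => (hp t).continuousAt
  have cq : Continuous q := continuous_iff_continuousAt.2 fun t => (hq t).continuousAt
  refine ⟨u, v, aux_contDiff hu hp (by fun_prop), aux_contDiff hv hq (by fun_prop), hup, hvp,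
    fun ξ => ?_, fun ξ => ?_, l1, l2, l3, l4, fun hmono => ?_, fun hanti => ?_⟩
  · rw [hdu, (hp ξ).deriv]; ring
  · rw [hdv, (hq ξ).deriv]; field_simp; ring
  · rw [← hV] at l4
    have hvV : ∀ t, v t ≤ V := fun t => hmono.ge_of_tendsto l4 t
    have hE : ∀ t, HasDerivAt (fun t => exp (-(s / 2) * t)) (exp (-(s / 2) * t) * (-(s / 2))) t :=
      fun t => by simpa using ((hasDerivAt_id t).const_mul (-(s / 2))).exp
    have hub : ∀ t, 0 ≤ t → t ≤ L → b * u t ≤ (a - V) / 2 := by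
      intro t ht htL
      have h1 := aux_anti (f := fun x => exp (-(s / 2) * x) * u x) ht
        (fun x _ _ => (hE x).mul (hu x)) (fun x g1 _ => by
          have := mul_nonneg (exp_pos (-(s / 2) * x)).le (sub_nonneg.2 (hpu x g1).le)
          linarith)
      simp only [mul_zero, exp_zero, one_mul, iu] at h1
      have h2 : exp (-(s / 2) * L) * u t ≤ exp (-(s / 2) * t) * u t := by
        refine mul_le_mul_of_nonneg_right (exp_le_exp.2 ?_) (hup t).le
        have := mul_le_mul_of_nonneg_left htL (by positivity : 0 ≤ s / 2)
        linarith
      have h3 : exp (-(s / 2) * L) * u t ≤ exp (-(s / 2) * L) * ((a - V) / 2 / b) := by linarith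
      have h4 := le_of_mul_le_mul_left h3 (exp_pos _)
      rw [le_div_iff₀ hb] at h4
      linarith
    have h1 := aux_int (d := -d) (s := -s) (m := m) hL0.le (fun t _ _ => hv t) (fun t _ _ => hq t)
      (fun t g1 g2 => by
        have e1 : -d * ((s * q t - v t * (a - b * u t - v t)) / d) - -s * q t
          = v t * (a - b * u t - v t) := by field_simp; ring
        rw [e1, hm]
        refine mul_le_mul (hvl t g1) ?_ (by linarith) (hvp t).le
        linarith [hub t g1 g2, hvV t])
    have h2 : 0 ≤ q L := by rw [← hdv]; exact hmono.deriv_nonneg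
    have h3 := hqv 0 le_rfl
    rw [iv] at h3
    have h4 : d * q 0 ≤ d * (s / (2 * d) * v0) := mul_le_mul_of_nonneg_left h3.le hd.le
    have h5 : d * (s / (2 * d) * v0) = s * v0 / 2 := by field_simp
    have h6 := mul_le_mul_of_nonneg_left (hvV L) hs0.le
    have h7 : 0 ≤ d * q L := by positivity
    have h8 : 0 < s * v0 := by positivity
    rw [iv, sub_zero, hmL] at h1
    linarith
  · have := ge_of_tendsto l2 (by filter_upwards [Iic_mem_atBot (0:ℝ)] with t ht using hanti ht)
    linarith [hvp 0]
end

section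
/- Assume 0 < b < a, a·c = 1, and d > 0 (critical weak competition). Then for every s ≥ s* := max{2, 2√(a·d)} there exists a non-trivial front-pulse solution: twice continuously differentiable functions u, v : ℝ → ℝ with u(ξ) ≥ 0, v(ξ) > 0 on ℝ, u not identically zero, satisfying u'' − s·u' + u·(1 − u − (1/a)·v) = 0 and d·v'' − s·v' + v·(a − b·u − v) = 0 on ℝ, together with lim_{ξ→−∞}(u(ξ), v(ξ)) = (0, 0), lim_{ξ→+∞}(u(ξ), v(ξ)) = (0, a); in particular u(ξ) → 0 as |ξ| → +∞. -/
open Filter Real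

theorem snd_deriv_nonpos {y y1 : ℝ → ℝ} {y2 x : ℝ}
    (hy : ∀ x, HasDerivAt y (y1 x) x) (hy1 : HasDerivAt y1 y2 x)
    (hm : IsLocalMax y x) : y1 x = 0 ∧ y2 ≤ 0 := by
  have h1 : y1 x = 0 := hm.hasDerivAt_eq_zero (hy x)
  refine ⟨h1, ?_⟩
  by_contra hcon
  push Not at hcon
  have hd : deriv y = y1 := funext fun t => (hy t).deriv
  have hmin : IsLocalMin y x := by
    apply isLocalMin_of_deriv_deriv_pos
    · rw [hd, hy1.deriv]; exact hcon
    · rw [hd]; exact h1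
    · exact (hy x).continuousAt
  have hc : ∀ᶠ t in nhds x, y t = y x := by
    filter_upwards [hm, hmin] with t h2 h3
    exact le_antisymm h2 h3
  have hc1 : ∀ᶠ t in nhds x, y1 t = 0 := by
    filter_upwards [hc.eventually_nhds] with t ht
    have : HasDerivAt y 0 t := (hasDerivAt_const t (y x)).congr_of_eventuallyEq ht
    exact (hy t).unique this
  have : HasDerivAt y1 0 x := (hasDerivAt_const x (0:ℝ)).congr_of_eventuallyEq hc1
  have := hy1.unique this
  linarith

theorem maxp {I : Set ℝ} (hI : IsClosed I) {z z1 z2 p p1 p2 : ℝ → ℝ} {σ γ B : ℝ} (hγ : 0 ≤ γ)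
    (hz : ∀ x, HasDerivAt z (z1 x) x) (hz1 : ∀ x, HasDerivAt z1 (z2 x) x)
    (hp : ∀ x, HasDerivAt p (p1 x) x) (hp1 : ∀ x, HasDerivAt p1 (p2 x) x)
    (hp0 : ∀ x ∈ I, 0 ≤ p x) (hpt : Tendsto p (cocompact ℝ ⊓ 𝓟 I) atTop)
    (hpp : ∀ x ∈ I, 0 < -p2 x + σ * p1 x + γ * p x)
    (hB : ∀ x ∈ I, z x ≤ B)
    (h : ∀ x ∈ I, 0 < z x → x ∈ interior I ∧ -z2 x + σ * z1 x + γ * z x ≤ 0) :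
    ∀ x ∈ I, z x ≤ 0 := by
  intro x₀ hx₀
  by_contra hcon
  push Not at hcon
  obtain ⟨ε, hε, hε2⟩ : ∃ ε : ℝ, 0 < ε ∧ ε * p x₀ < z x₀ := by
    refine ⟨z x₀ / (2 * (p x₀ + 1)), ?_, ?_⟩
    · have := hp0 x₀ hx₀; positivity
    · have := hp0 x₀ hx₀
      rw [div_mul_eq_mul_div, div_lt_iff₀ (by positivity)]
      nlinarith
  have hy : ∀ x, HasDerivAt (fun t => z t - ε * p t) (z1 x - ε * p1 x) x :=
    fun x => (hz x).sub ((hp x).const_mul ε)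
  have hy1 : ∀ x, HasDerivAt (fun t => z1 t - ε * p1 t) (z2 x - ε * p2 x) x :=
    fun x => (hz1 x).sub ((hp1 x).const_mul ε)
  have hcont : Continuous (fun t => z t - ε * p t) :=
    continuous_iff_continuousAt.2 fun x => (hy x).continuousAt
  obtain ⟨x, hxI, hx⟩ := hcont.continuousOn.exists_isMaxOn' hI hx₀ (by
    have h1 := hpt.eventually_ge_atTop ((B - (z x₀ - ε * p x₀)) / ε)
    have h2 : ∀ᶠ t in cocompact ℝ ⊓ 𝓟 I, t ∈ I := mem_inf_of_right (mem_principal_self I)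
    filter_upwards [h1, h2] with t ht htI
    rw [div_le_iff₀ hε] at ht
    have := hB t htI
    linarith)
  have hx0 := hx hx₀
  simp only [Set.mem_ofPred_eq] at hx0
  have hpx := hp0 x hxI
  have hzx : 0 < z x := by nlinarith
  obtain ⟨hxi, hineq⟩ := h x hxI hzx
  have hloc : IsLocalMax (fun t => z t - ε * p t) x :=
    hx.isLocalMax (mem_interior_iff_mem_nhds.1 hxi)
  obtain ⟨e1, e2⟩ := snd_deriv_nonpos hy (hy1 x) hloc
  have e3 := hpp x hxI
  have e4 : 0 ≤ γ * (z x - ε * p x) := mul_nonneg hγ (by linarith)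
  have e5 : z1 x = ε * p1 x := by linarith
  rw [e5] at hineq
  nlinarith [mul_pos hε e3]

theorem cosh_tendsto {τ : ℝ} (hτ : 0 < τ) (I : Set ℝ) :
    Tendsto (fun x : ℝ => exp (τ * x) + exp (-τ * x)) (cocompact ℝ ⊓ 𝓟 I) atTop := by
  refine Tendsto.mono_left ?_ inf_le_left
  have h : Tendsto (fun x : ℝ => τ * ‖x‖) (cocompact ℝ) atTop :=
    (tendsto_norm_cocompact_atTop).const_mul_atTop hτ
  refine tendsto_atTop_mono ?_ h
  intro x
  have a1 := add_one_le_exp (τ * x)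
  have a2 := add_one_le_exp (-τ * x)
  have a3 := exp_pos (τ * x)
  have a4 := exp_pos (-τ * x)
  rw [Real.norm_eq_abs]
  rcases abs_cases x with ⟨h, _⟩ | ⟨h, _⟩ <;> rw [h] <;> nlinarith

theorem hexp (r x : ℝ) : HasDerivAt (fun t : ℝ => exp (r * t)) (r * exp (r * x)) x := by
  have := ((hasDerivAt_id x).const_mul r).exp
  simpa [mul_comm] using this

/-- bounded maximum principle with positive zero-order term -/
theorem maxp1 {I : Set ℝ} (hI : IsClosed I) {z z1 z2 : ℝ → ℝ} {σ γ B : ℝ} (hσ : 0 < σ)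
    (hγ : 0 < γ)
    (hz : ∀ x, HasDerivAt z (z1 x) x) (hz1 : ∀ x, HasDerivAt z1 (z2 x) x)
    (hB : ∀ x ∈ I, z x ≤ B)
    (h : ∀ x ∈ I, 0 < z x → x ∈ interior I ∧ -z2 x + σ * z1 x + γ * z x ≤ 0) :
    ∀ x ∈ I, z x ≤ 0 := by
  obtain ⟨τ, hτ, hτ2⟩ : ∃ τ : ℝ, 0 < τ ∧ τ ^ 2 + σ * τ < γ := by
    refine ⟨γ / (2 * (γ + σ + 1)), by positivity, ?_⟩
    set t := γ / (2 * (γ + σ + 1)) with ht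
    have h1 : t * (2 * (γ + σ + 1)) = γ := by rw [ht]; field_simp
    have h2 : 0 < t := by positivity
    have h3 : t < 1 := by rw [ht, div_lt_one (by positivity)]; linarith
    nlinarith
  refine maxp (p := fun x => exp (τ * x) + exp (-τ * x))
    (p1 := fun x => τ * exp (τ * x) + -τ * exp (-τ * x))
    (p2 := fun x => τ * (τ * exp (τ * x)) + -τ * (-τ * exp (-τ * x))) hI hγ.le hz hz1
    (fun x => (hexp τ x).add (hexp (-τ) x))
    (fun x => ((hexp τ x).const_mul τ).add ((hexp (-τ) x).const_mul (-τ)))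
    (fun x _ => by positivity) (cosh_tendsto hτ I) ?_ hB h
  intro x _
  have a3 := exp_pos (τ * x)
  have a4 := exp_pos (-τ * x)
  have b1 : 0 < exp (τ * x) * (γ - τ ^ 2 + σ * τ) := mul_pos a3 (by nlinarith)
  have b2 : 0 < exp (-τ * x) * (γ - τ ^ 2 - σ * τ) := mul_pos a4 (by nlinarith)
  nlinarith

/-- bounded maximum principle on a right half line, no zero-order term -/
theorem maxp2 {R : ℝ} {z z1 z2 : ℝ → ℝ} {σ B : ℝ} (hσ : 0 < σ)
    (hz : ∀ x, HasDerivAt z (z1 x) x) (hz1 : ∀ x, HasDerivAt z1 (z2 x) x)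
    (hB : ∀ x, R ≤ x → z x ≤ B)
    (h : ∀ x, R ≤ x → 0 < z x → R < x ∧ -z2 x + σ * z1 x ≤ 0) :
    ∀ x, R ≤ x → z x ≤ 0 := by
  refine maxp (I := Set.Ici R) (p := fun x => x - R) (p1 := fun _ => 1) (p2 := fun _ => 0)
    (σ := σ) (B := B) isClosed_Ici le_rfl hz hz1 (fun x => (hasDerivAt_id x).sub_const R)
    (fun x => hasDerivAt_const x _) (fun x hx => sub_nonneg.2 hx) ?_ (fun x _ => by simpa using hσ)
    hB ?_
  · have h1 : Tendsto (fun x : ℝ => ‖x‖ - R) (cocompact ℝ ⊓ 𝓟 (Set.Ici R)) atTop := by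
      apply tendsto_atTop_add_const_right
      exact tendsto_norm_cocompact_atTop.mono_left inf_le_left
    rw [tendsto_atTop] at h1 ⊢
    intro b
    have h2 : ∀ᶠ t in cocompact ℝ ⊓ 𝓟 (Set.Ici R), t ∈ Set.Ici R :=
      mem_inf_of_right (mem_principal_self _)
    filter_upwards [h1 (max b (|R| - R + 1)), h2] with t ht ht2
    have h3 : |R| + 1 ≤ ‖t‖ := by have := (le_max_right _ _).trans ht; linarith
    have h4 : b ≤ ‖t‖ - R := (le_max_left _ _).trans ht
    rw [Real.norm_eq_abs] at h3 h4
    have h5 : R ≤ t := ht2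
    rcases abs_cases t with ⟨e, _⟩ | ⟨e, _⟩
    · rw [e] at h4; exact h4
    · have := neg_abs_le R
      linarith
  · intro x hx hzx
    obtain ⟨h1, h2⟩ := h x hx hzx
    refine ⟨by simpa using h1, by linarith⟩

theorem decay {R : ℝ} {z z1 z2 : ℝ → ℝ} {σ B l δ : ℝ} (hσ : 0 < σ) (hδ : 0 < δ)
    (hz : ∀ x, HasDerivAt z (z1 x) x) (hz1 : ∀ x, HasDerivAt z1 (z2 x) x)
    (hB : ∀ x, R ≤ x → z x ≤ B)
    (h : ∀ x, R ≤ x → l < z x → -z2 x + σ * z1 x ≤ -δ) {ε : ℝ} (hε : 0 < ε) :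
    ∀ᶠ x in atTop, z x ≤ l + ε := by
  obtain ⟨C, hC, hCB⟩ : ∃ C : ℝ, 0 < C ∧ B - l < C := ⟨|B - l| + 1, by positivity,
    by have := le_abs_self (B - l); linarith⟩
  obtain ⟨τ, hτ, hτ2⟩ : ∃ τ : ℝ, 0 < τ ∧ C * (τ ^ 2 + σ * τ) ≤ δ := by
    refine ⟨δ / (C * (δ / C + σ + 1)), by positivity, ?_⟩
    set t := δ / (C * (δ / C + σ + 1)) with ht
    have h1 : t * (C * (δ / C + σ + 1)) = δ := by rw [ht]; field_simp
    have h2 : 0 < t := by positivity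
    have h3 : t ≤ 1 := by
      rw [ht, div_le_one (by positivity)]
      have : C * (δ / C + σ + 1) = δ + C * σ + C := by field_simp
      rw [this]; nlinarith
    have h4 : t ^ 2 + σ * t ≤ t * (δ / C + σ + 1) := by
      have : 0 < δ / C := by positivity
      nlinarith
    nlinarith
  have key : ∀ x, R ≤ x → z x - l - C * exp (τ * R) * exp (-τ * x) ≤ 0 := by
    refine maxp2 (z1 := fun x => z1 x - C * exp (τ * R) * (-τ * exp (-τ * x)))
      (z2 := fun x => z2 x - C * exp (τ * R) * (-τ * (-τ * exp (-τ * x)))) (B := B - l) hσ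
      (fun x => ((hz x).sub_const l).sub ((hexp (-τ) x).const_mul _))
      (fun x => (hz1 x).sub (((hexp (-τ) x).const_mul _).const_mul _)) ?_ ?_
    · intro x hx
      have := hB x hx
      have : 0 < C * exp (τ * R) * exp (-τ * x) := by positivity
      linarith
    · intro x hx hpos
      have hE : 0 < C * exp (τ * R) * exp (-τ * x) := by positivity
      have hE2 : exp (τ * R) * exp (-τ * x) ≤ 1 := by
        rw [← exp_add, exp_le_one_iff]; nlinarith
      have h2 := h x hx (by linarith)
      constructor
      · rcases hx.lt_or_eq with h3 | h3
        · exact h3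
        · exfalso
          subst h3
          have : exp (τ * R) * exp (-τ * R) = 1 := by rw [← exp_add]; simp
          have := hB R le_rfl
          nlinarith
      · have : C * (τ ^ 2 + σ * τ) * (exp (τ * R) * exp (-τ * x)) ≤ δ * 1 :=
          mul_le_mul hτ2 hE2 (by positivity) hδ.le
        nlinarith
  have hlim : Tendsto (fun x : ℝ => C * exp (τ * R) * exp (-τ * x)) atTop (nhds 0) := by
    have : Tendsto (fun x : ℝ => exp (-τ * x)) atTop (nhds 0) := by
      apply tendsto_exp_atBot.comp
      exact tendsto_id.const_mul_atTop_of_neg (by linarith)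
    simpa using this.const_mul (C * exp (τ * R))
  filter_upwards [hlim.eventually_le_const hε, eventually_ge_atTop R] with x h1 h2
  have := key x h2
  linarith
noncomputable def KA (p : ℝ) (f : ℝ → ℝ) (x : ℝ) : ℝ := ∫ t in Set.Iic x, exp (p * t) * f t
noncomputable def KB (q : ℝ) (f : ℝ → ℝ) (x : ℝ) : ℝ := ∫ t in Set.Ioi x, exp (-q * t) * f t
noncomputable def KK (p q : ℝ) (f : ℝ → ℝ) (x : ℝ) : ℝ :=
  (p + q)⁻¹ * (exp (-p * x) * KA p f x + exp (q * x) * KB q f x)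

section kernel
variable {p q B : ℝ} {f : ℝ → ℝ}

theorem intA (hp : 0 < p) (hf : Measurable f) (hB : ∀ x, |f x| ≤ B) (x : ℝ) :
    MeasureTheory.IntegrableOn (fun t => exp (p * t) * f t) (Set.Iic x) := by
  refine (MeasureTheory.Integrable.mono' ((integrableOn_exp_mul_Iic hp x).mul_const B) ?_ ?_)
  · exact Measurable.aestronglyMeasurable (by fun_prop)
  · refine MeasureTheory.ae_of_all _ fun t => ?_
    rw [Real.norm_eq_abs, abs_mul, abs_of_pos (exp_pos _)]
    exact mul_le_mul_of_nonneg_left (hB t) (exp_pos _).le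

theorem intB (hq : 0 < q) (hf : Measurable f) (hB : ∀ x, |f x| ≤ B) (x : ℝ) :
    MeasureTheory.IntegrableOn (fun t => exp (-q * t) * f t) (Set.Ioi x) := by
  refine (MeasureTheory.Integrable.mono'
    ((integrableOn_exp_mul_Ioi (neg_lt_zero.2 hq) x).mul_const B) ?_ ?_)
  · exact Measurable.aestronglyMeasurable (by fun_prop)
  · refine MeasureTheory.ae_of_all _ fun t => ?_
    rw [Real.norm_eq_abs, abs_mul, abs_of_pos (exp_pos _)]
    exact mul_le_mul_of_nonneg_left (hB t) (exp_pos _).le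

theorem intI (r : ℝ) (hf : Measurable f) (hB : ∀ x, |f x| ≤ B) (x y : ℝ) :
    IntervalIntegrable (fun t => exp (r * t) * f t) MeasureTheory.volume x y := by
  have h : IntervalIntegrable (fun t => exp (r * t) * B) MeasureTheory.volume x y :=
    Continuous.intervalIntegrable (by fun_prop) _ _
  refine h.mono_fun' (Measurable.aestronglyMeasurable (by fun_prop)) ?_
  refine MeasureTheory.ae_of_all _ fun t => ?_
  show ‖_‖ ≤ _
  rw [Real.norm_eq_abs, abs_mul, abs_of_pos (exp_pos _)]
  exact mul_le_mul_of_nonneg_left (hB t) (exp_pos _).le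

theorem KA_eq (hp : 0 < p) (hf : Measurable f) (hB : ∀ x, |f x| ≤ B) (x : ℝ) :
    KA p f x = KA p f 0 + ∫ t in (0:ℝ)..x, exp (p * t) * f t := by
  have := intervalIntegral.integral_Iic_sub_Iic (intA hp hf hB 0) (intA hp hf hB x)
  unfold KA
  linarith

theorem KB_eq (hq : 0 < q) (hf : Measurable f) (hB : ∀ x, |f x| ≤ B) (x : ℝ) :
    KB q f x = KB q f 0 - ∫ t in (0:ℝ)..x, exp (-q * t) * f t := by
  have := intervalIntegral.integral_interval_add_Ioi (intB hq hf hB 0) (intB hq hf hB x)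
  unfold KB
  linarith

theorem KK_cont (hp : 0 < p) (hq : 0 < q) (hf : Measurable f) (hB : ∀ x, |f x| ≤ B) :
    Continuous (KK p q f) := by
  have h1 : Continuous (KA p f) := by
    rw [funext (KA_eq hp hf hB)]
    exact continuous_const.add (intervalIntegral.continuous_primitive (intI p hf hB) 0)
  have h2 : Continuous (KB q f) := by
    rw [funext (KB_eq hq hf hB)]
    exact continuous_const.sub (intervalIntegral.continuous_primitive (intI (-q) hf hB) 0)
  unfold KK
  fun_prop

theorem KA_bd (hp : 0 < p) (hB : ∀ x, |f x| ≤ B) (x : ℝ) :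
    |KA p f x| ≤ exp (p * x) / p * B := by
  have h := MeasureTheory.norm_integral_le_of_norm_le
    (μ := MeasureTheory.volume.restrict (Set.Iic x)) (f := fun t => exp (p * t) * f t)
    ((integrableOn_exp_mul_Iic hp x).mul_const B) (MeasureTheory.ae_of_all _ fun t => by
      rw [Real.norm_eq_abs, abs_mul, abs_of_pos (exp_pos _)]
      exact mul_le_mul_of_nonneg_left (hB t) (exp_pos _).le)
  rw [MeasureTheory.integral_mul_const, integral_exp_mul_Iic hp] at h
  exact h

theorem KB_bd (hq : 0 < q) (hB : ∀ x, |f x| ≤ B) (x : ℝ) :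
    |KB q f x| ≤ exp (-q * x) / q * B := by
  have h := MeasureTheory.norm_integral_le_of_norm_le
    (μ := MeasureTheory.volume.restrict (Set.Ioi x)) (f := fun t => exp (-q * t) * f t)
    ((integrableOn_exp_mul_Ioi (neg_lt_zero.2 hq) x).mul_const B) (MeasureTheory.ae_of_all _ fun t => by
      rw [Real.norm_eq_abs, abs_mul, abs_of_pos (exp_pos _)]
      exact mul_le_mul_of_nonneg_left (hB t) (exp_pos _).le)
  rw [MeasureTheory.integral_mul_const, integral_exp_mul_Ioi (neg_lt_zero.2 hq)] at h
  rw [neg_div_neg_eq] at h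
  exact h

theorem KK_bd (hp : 0 < p) (hq : 0 < q) (hB : ∀ x, |f x| ≤ B) (x : ℝ) :
    |KK p q f x| ≤ (p + q)⁻¹ * (B / p + B / q) := by
  unfold KK
  rw [abs_mul, abs_of_pos (by positivity : 0 < (p + q)⁻¹)]
  refine mul_le_mul_of_nonneg_left ?_ (by positivity)
  refine (abs_add_le _ _).trans (add_le_add ?_ ?_)
  · rw [abs_mul, abs_of_pos (exp_pos _)]
    refine (mul_le_mul_of_nonneg_left (KA_bd hp hB x) (exp_pos _).le).trans_eq ?_
    have : exp (-p * x) * exp (p * x) = 1 := by rw [← exp_add]; simp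
    calc _ = exp (-p * x) * exp (p * x) * (B / p) := by ring
      _ = _ := by rw [this, one_mul]
  · rw [abs_mul, abs_of_pos (exp_pos _)]
    refine (mul_le_mul_of_nonneg_left (KB_bd hq hB x) (exp_pos _).le).trans_eq ?_
    have : exp (q * x) * exp (-q * x) = 1 := by rw [← exp_add]; simp
    calc _ = exp (q * x) * exp (-q * x) * (B / q) := by ring
      _ = _ := by rw [this, one_mul]

theorem KK_lim (hp : 0 < p) (hq : 0 < q) {g : ℕ → ℝ → ℝ} (hg : ∀ n, Measurable (g n))
    (hB : ∀ n x, |g n x| ≤ B) (hl : ∀ x, Tendsto (fun n => g n x) atTop (nhds (f x))) (x : ℝ) :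
    Tendsto (fun n => KK p q (g n) x) atTop (nhds (KK p q f x)) := by
  have h1 : Tendsto (fun n => KA p (g n) x) atTop (nhds (KA p f x)) := by
    refine MeasureTheory.tendsto_integral_of_dominated_convergence (fun t => exp (p * t) * B)
      (fun n => ?_) ((integrableOn_exp_mul_Iic hp x).mul_const B) (fun n => MeasureTheory.ae_of_all _ fun t => ?_)
      (MeasureTheory.ae_of_all _ fun t => (hl t).const_mul _)
    · have := hg n
      exact Measurable.aestronglyMeasurable (by fun_prop)
    · rw [Real.norm_eq_abs, abs_mul, abs_of_pos (exp_pos _)]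
      exact mul_le_mul_of_nonneg_left (hB n t) (exp_pos _).le
  have h2 : Tendsto (fun n => KB q (g n) x) atTop (nhds (KB q f x)) := by
    refine MeasureTheory.tendsto_integral_of_dominated_convergence (fun t => exp (-q * t) * B)
      (fun n => ?_) ((integrableOn_exp_mul_Ioi (neg_lt_zero.2 hq) x).mul_const B)
      (fun n => MeasureTheory.ae_of_all _ fun t => ?_) (MeasureTheory.ae_of_all _ fun t => (hl t).const_mul _)
    · have := hg n
      exact Measurable.aestronglyMeasurable (by fun_prop)
    · rw [Real.norm_eq_abs, abs_mul, abs_of_pos (exp_pos _)]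
      exact mul_le_mul_of_nonneg_left (hB n t) (exp_pos _).le
  exact ((h1.const_mul _).add (h2.const_mul _)).const_mul _

noncomputable def KK1 (p q : ℝ) (f : ℝ → ℝ) (x : ℝ) : ℝ :=
  (p + q)⁻¹ * (-p * (exp (-p * x) * KA p f x) + q * (exp (q * x) * KB q f x))

theorem KA_deriv (hp : 0 < p) (hf : Continuous f) (hB : ∀ x, |f x| ≤ B) (x : ℝ) :
    HasDerivAt (KA p f) (exp (p * x) * f x) x := by
  rw [funext (KA_eq hp hf.measurable hB)]
  have hc : Continuous (fun t => exp (p * t) * f t) := by fun_prop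
  exact (hc.integral_hasStrictDerivAt 0 x).hasDerivAt.const_add _

theorem KB_deriv (hq : 0 < q) (hf : Continuous f) (hB : ∀ x, |f x| ≤ B) (x : ℝ) :
    HasDerivAt (KB q f) (-(exp (-q * x) * f x)) x := by
  rw [funext (KB_eq hq hf.measurable hB)]
  have hc : Continuous (fun t => exp (-q * t) * f t) := by fun_prop
  exact (hc.integral_hasStrictDerivAt 0 x).hasDerivAt.const_sub _

theorem KK_deriv (hp : 0 < p) (hq : 0 < q) (hf : Continuous f) (hB : ∀ x, |f x| ≤ B) (x : ℝ) :
    HasDerivAt (KK p q f) (KK1 p q f x) x := by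
  have h := (((hexp (-p) x).mul (KA_deriv hp hf hB x)).add
    ((hexp q x).mul (KB_deriv hq hf hB x))).const_mul (p + q)⁻¹
  refine h.congr_deriv ?_
  have e1 : exp (-p * x) * exp (p * x) = 1 := by rw [← exp_add]; simp
  have e2 : exp (q * x) * exp (-q * x) = 1 := by rw [← exp_add]; simp
  unfold KK1
  linear_combination (p + q)⁻¹ * f x * e1 - (p + q)⁻¹ * f x * e2

theorem KK1_deriv (hp : 0 < p) (hq : 0 < q) (hf : Continuous f) (hB : ∀ x, |f x| ≤ B) (x : ℝ) :
    HasDerivAt (KK1 p q f) ((q - p) * KK1 p q f x + p * q * KK p q f x - f x) x := by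
  have h := ((((hexp (-p) x).mul (KA_deriv hp hf hB x)).const_mul (-p)).add
    (((hexp q x).mul (KB_deriv hq hf hB x)).const_mul q)).const_mul (p + q)⁻¹
  refine h.congr_deriv ?_
  have e1 : exp (-p * x) * exp (p * x) = 1 := by rw [← exp_add]; simp
  have e2 : exp (q * x) * exp (-q * x) = 1 := by rw [← exp_add]; simp
  have e3 : (p + q)⁻¹ * (p + q) = 1 := inv_mul_cancel₀ (by positivity)
  unfold KK1 KK
  linear_combination -p * (p + q)⁻¹ * f x * e1 - q * (p + q)⁻¹ * f x * e2 - f x * e3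

end kernel
structure IsProf (σ k ε : ℝ) (P P1 P2 Q Q1 Q2 : ℝ → ℝ) (M : ℝ) : Prop where
  dP : ∀ x, HasDerivAt P (P1 x) x
  dP1 : ∀ x, HasDerivAt P1 (P2 x) x
  dQ : ∀ x, HasDerivAt Q (Q1 x) x
  dQ1 : ∀ x, HasDerivAt Q1 (Q2 x) x
  eqP : ∀ x, P2 x - σ * P1 x + k * P x = 0
  P0 : P 0 = 1
  Ppos : ∀ x, x ≤ 0 → 0 < P x
  Ple : ∀ x, x ≤ 0 → P x ≤ 1
  Pexp : ∀ x, x ≤ 0 → P x ≤ 2 * exp (ε * x)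
  QP : ∀ x, x ≤ 0 → Q x ≤ P x
  Q0 : Q 0 ≤ 0
  subQ : ∀ x, x ≤ 0 → 4 * k * exp (ε * x) * P x ≤ Q2 x - σ * Q1 x + k * Q x
  M0 : M ≤ 0
  Qpos : ∀ x, x ≤ M → 0 < Q x

theorem prof_noncrit {σ k : ℝ} (hσ : 0 < σ) (hk : 0 < k) (h : 4 * k < σ ^ 2) :
    ∃ ε0 : ℝ, 0 < ε0 ∧ ∀ ε, 0 < ε → ε ≤ ε0 →
      ∃ P P1 P2 Q Q1 Q2 M, IsProf σ k ε P P1 P2 Q Q1 Q2 M := by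
  obtain ⟨D, hD, hD2⟩ : ∃ D : ℝ, 0 < D ∧ D ^ 2 = σ ^ 2 - 4 * k :=
    ⟨√(σ ^ 2 - 4 * k), Real.sqrt_pos.2 (by linarith), Real.sq_sqrt (by linarith)⟩
  obtain ⟨l, hl⟩ : ∃ l : ℝ, l = (σ - D) / 2 := ⟨_, rfl⟩
  have hDσ : D < σ := by nlinarith
  have hl0 : 0 < l := by linarith
  have hleq : l ^ 2 - σ * l + k = 0 := by rw [hl]; nlinarith
  refine ⟨l, hl0, fun ε hε hεl => ?_⟩
  obtain ⟨η, hη, hηε, hηD⟩ : ∃ η : ℝ, 0 < η ∧ η ≤ ε ∧ η < D :=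
    ⟨min ε (D / 2), by positivity, min_le_left _ _, (min_le_right _ _).trans_lt (by linarith)⟩
  obtain ⟨δ, hδ⟩ : ∃ δ : ℝ, δ = η * (D - η) := ⟨_, rfl⟩
  have hδ0 : 0 < δ := by rw [hδ]; exact mul_pos hη (by linarith)
  have hδeq : (l + η) ^ 2 - σ * (l + η) + k = -δ := by rw [hδ]; nlinarith
  obtain ⟨q, hq1, hqδ⟩ : ∃ q : ℝ, 1 ≤ q ∧ 4 * k ≤ q * δ := by
    refine ⟨1 + 4 * k / δ, ?_, ?_⟩
    · have : 0 < 4 * k / δ := by positivity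
      linarith
    · rw [add_mul, div_mul_cancel₀ _ hδ0.ne']; linarith
  have hsplit : ∀ x, exp ((l + η) * x) = exp (l * x) * exp (η * x) := by
    intro x; rw [← exp_add]; ring_nf
  refine ⟨fun x => exp (l * x), fun x => l * exp (l * x), fun x => l * (l * exp (l * x)),
    fun x => exp (l * x) - q * exp ((l + η) * x),
    fun x => l * exp (l * x) - q * ((l + η) * exp ((l + η) * x)),
    fun x => l * (l * exp (l * x)) - q * ((l + η) * ((l + η) * exp ((l + η) * x))),
    -(q / η), ?_⟩
  constructor
  · exact fun x => hexp l x
  · exact fun x => (hexp l x).const_mul l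
  · exact fun x => (hexp l x).sub ((hexp (l + η) x).const_mul q)
  · exact fun x => ((hexp l x).const_mul l).sub (((hexp (l + η) x).const_mul _).const_mul q)
  · intro x; linear_combination exp (l * x) * hleq
  · simp
  · exact fun x _ => exp_pos _
  · intro x hx; rw [exp_le_one_iff]; nlinarith
  · intro x hx
    have : exp (l * x) ≤ exp (ε * x) := exp_le_exp.2 (by nlinarith)
    have := exp_pos (ε * x)
    linarith
  · intro x hx
    have : 0 < q * exp ((l + η) * x) := by positivity
    linarith
  · simp; linarith
  · intro x hx
    have e1 : exp (ε * x) ≤ exp (η * x) := exp_le_exp.2 (by nlinarith)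
    have e2 : l * (l * exp (l * x)) - q * ((l + η) * ((l + η) * exp ((l + η) * x))) -
      σ * (l * exp (l * x) - q * ((l + η) * exp ((l + η) * x))) +
      k * (exp (l * x) - q * exp ((l + η) * x)) = q * δ * (exp (l * x) * exp (η * x)) := by
      rw [← hsplit]
      linear_combination exp (l * x) * hleq - q * exp ((l + η) * x) * hδeq
    rw [e2]
    have : 4 * k * exp (ε * x) ≤ q * δ * exp (η * x) :=
      mul_le_mul hqδ e1 (exp_pos _).le (by positivity)
    calc _ ≤ q * δ * exp (η * x) * exp (l * x) :=
          mul_le_mul_of_nonneg_right this (exp_pos _).le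
      _ = _ := by ring
  · have : 0 < q / η := by positivity
    linarith
  · intro x hx
    rw [hsplit]
    have h1 : η * x ≤ -q := by
      have : η * x ≤ η * (-(q / η)) := mul_le_mul_of_nonneg_left hx hη.le
      have e : η * (-(q / η)) = -q := by field_simp
      linarith
    have h2 : exp (η * x) ≤ exp (-q) := exp_le_exp.2 h1
    have h3 : q * exp (-q) < 1 := by
      have := add_one_le_exp q
      rw [exp_neg, ← div_eq_mul_inv, div_lt_one (exp_pos _)]
      linarith
    have h4 : q * exp (η * x) < 1 := by nlinarith
    have := mul_pos (exp_pos (l * x)) (sub_pos.2 h4)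
    linarith

theorem prof_crit {σ k : ℝ} (hσ : 0 < σ) (hk : 0 < k) (h : 4 * k = σ ^ 2) :
    ∃ ε0 : ℝ, 0 < ε0 ∧ ∀ ε, 0 < ε → ε ≤ ε0 →
      ∃ P P1 P2 Q Q1 Q2 M, IsProf σ k ε P P1 P2 Q Q1 Q2 M := by
  obtain ⟨l, hl⟩ : ∃ l : ℝ, l = σ / 2 := ⟨_, rfl⟩
  have hl0 : 0 < l := by linarith
  have hkl : k = l ^ 2 := by rw [hl]; nlinarith
  have hσl : σ = 2 * l := by linarith
  subst hσl hkl
  refine ⟨l / 2, by linarith, fun ε hε hεl => ?_⟩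
  obtain ⟨η, hη, hηε⟩ : ∃ η : ℝ, 0 < η ∧ 2 * η = ε := ⟨ε / 2, by positivity, by ring⟩
  obtain ⟨q, hq, hqη⟩ : ∃ q : ℝ, 0 < q ∧ q * η ^ 2 = 4 * l ^ 2 * (1 + l / η) := by
    refine ⟨4 * l ^ 2 * (1 + l / η) / η ^ 2, by positivity, by field_simp⟩
  have hsplit : ∀ x, exp ((l + η) * x) = exp (l * x) * exp (η * x) := by
    intro x; rw [← exp_add]; ring_nf
  have hxe : ∀ x, HasDerivAt (fun t : ℝ => t * exp (l * t))
      (exp (l * x) + l * (x * exp (l * x))) x := fun x => by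
    refine ((hasDerivAt_id x).mul (hexp l x)).congr_deriv ?_
    simp only [id]; ring
  refine ⟨fun x => exp (l * x) - l * (x * exp (l * x)),
    fun x => l * exp (l * x) - l * (exp (l * x) + l * (x * exp (l * x))),
    fun x => l * (l * exp (l * x)) - l * (l * exp (l * x) +
      l * (exp (l * x) + l * (x * exp (l * x)))),
    fun x => -l * (x * exp (l * x)) - q * exp (l * x) + q * exp ((l + η) * x),
    fun x => -l * (exp (l * x) + l * (x * exp (l * x))) - q * (l * exp (l * x)) +
      q * ((l + η) * exp ((l + η) * x)),
    fun x => -l * (l * exp (l * x) + l * (exp (l * x) + l * (x * exp (l * x)))) -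
      q * (l * (l * exp (l * x))) + q * ((l + η) * ((l + η) * exp ((l + η) * x))),
    -((q + 1) / l), ?_⟩
  constructor
  · exact fun x => (hexp l x).sub ((hxe x).const_mul l)
  · exact fun x => ((hexp l x).const_mul l).sub
      (((hexp l x).add ((hxe x).const_mul l)).const_mul l)
  · exact fun x => (((hxe x).const_mul (-l)).sub ((hexp l x).const_mul q)).add
      ((hexp (l + η) x).const_mul q)
  · exact fun x => ((((hexp l x).add ((hxe x).const_mul l)).const_mul (-l)).sub
      (((hexp l x).const_mul l).const_mul q)).add
      (((hexp (l + η) x).const_mul (l + η)).const_mul q)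
  · intro x; ring
  · simp
  · intro x hx
    have : 0 ≤ (-x) * (l * exp (l * x)) := mul_nonneg (by linarith) (by positivity)
    have := exp_pos (l * x)
    nlinarith
  · intro x hx
    have h1 := add_one_le_exp (-(l * x))
    have h2 : exp (-(l * x)) * exp (l * x) = 1 := by rw [← exp_add]; simp
    have h3 := mul_le_mul_of_nonneg_right h1 (exp_pos (l * x)).le
    nlinarith
  · intro x hx
    have h1 := add_one_le_exp (-(l / 2 * x))
    have h2 : exp (-(l / 2 * x)) * exp (l * x) = exp (l / 2 * x) := by
      rw [← exp_add]; ring_nf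
    have h3 := mul_le_mul_of_nonneg_right h1 (exp_pos (l * x)).le
    have h4 : exp (l / 2 * x) ≤ exp (ε * x) := exp_le_exp.2 (by nlinarith)
    have := exp_pos (l * x)
    nlinarith
  · intro x hx
    rw [hsplit]
    have h1 : exp (η * x) ≤ 1 := by rw [exp_le_one_iff]; nlinarith
    have h2 := mul_le_mul_of_nonneg_left h1 (mul_pos hq (exp_pos (l * x))).le
    have := exp_pos (l * x)
    nlinarith
  · simp
  · intro x hx
    have e2 : -l * (l * exp (l * x) + l * (exp (l * x) + l * (x * exp (l * x)))) -
      q * (l * (l * exp (l * x))) + q * ((l + η) * ((l + η) * exp ((l + η) * x))) -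
      2 * l * (-l * (exp (l * x) + l * (x * exp (l * x))) - q * (l * exp (l * x)) +
      q * ((l + η) * exp ((l + η) * x))) + l ^ 2 * (-l * (x * exp (l * x)) - q * exp (l * x) +
      q * exp ((l + η) * x)) = 4 * l ^ 2 * ((1 + l / η) * exp (η * x)) * exp (l * x) := by
      rw [hsplit]
      linear_combination exp (l * x) * exp (η * x) * hqη
    rw [e2]
    have h1 := add_one_le_exp (-(η * x))
    have h2 : exp (-(η * x)) * exp (ε * x) = exp (η * x) := by
      rw [← exp_add, ← hηε]; ring_nf
    have h3 : (1 - l * x) * exp (ε * x) ≤ (1 + l / η) * exp (η * x) := by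
      rw [← h2, ← mul_assoc]
      refine mul_le_mul_of_nonneg_right ?_ (exp_pos _).le
      have h5 : l / η * (-(η * x) + 1) = -l * x + l / η := by field_simp
      have h6 : 0 < l / η := by positivity
      have h7 := mul_le_mul_of_nonneg_left h1 h6.le
      have h8 : 1 ≤ exp (-(η * x)) := by
        rw [one_le_exp_iff]; nlinarith
      nlinarith
    calc _ = 4 * l ^ 2 * ((1 - l * x) * exp (ε * x)) * exp (l * x) := by ring
      _ ≤ _ := by gcongr
  · have : 0 < (q + 1) / l := by positivity
    linarith
  · intro x hx
    have h1 : l * x ≤ -(q + 1) := by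
      have : l * x ≤ l * (-((q + 1) / l)) := mul_le_mul_of_nonneg_left hx hl0.le
      have e : l * (-((q + 1) / l)) = -(q + 1) := by field_simp
      linarith
    have h2 : 0 < (-(l * x) - q) * exp (l * x) := mul_pos (by linarith) (exp_pos _)
    have h3 : 0 < q * exp ((l + η) * x) := by positivity
    nlinarith

theorem prof {σ k : ℝ} (hσ : 0 < σ) (hk : 0 < k) (h : 4 * k ≤ σ ^ 2) :
    ∃ ε0 : ℝ, 0 < ε0 ∧ ∀ ε, 0 < ε → ε ≤ ε0 →
      ∃ P P1 P2 Q Q1 Q2 M, IsProf σ k ε P P1 P2 Q Q1 Q2 M := by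
  rcases h.lt_or_eq with h | h
  · exact prof_noncrit hσ hk h
  · exact prof_crit hσ hk h
noncomputable def ub (P : ℝ → ℝ) (x : ℝ) : ℝ := if x ≤ 0 then P x else 1
noncomputable def lb (Q : ℝ → ℝ) (x : ℝ) : ℝ := if x ≤ 0 then max 0 (Q x) else 0
def FF (γ k α u w : ℝ) : ℝ := γ * u + k * u * (1 - u - α * w)

theorem FF_nonneg {γ k α u w : ℝ} (hk : 0 < k) (hγ : 2 * k ≤ γ) (hα : 0 ≤ α) (hα1 : α ≤ 1)
    (hu : 0 ≤ u) (hu1 : u ≤ 1) (hw1 : w ≤ 1) : 0 ≤ FF γ k α u w := by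
  have h1 : α * w ≤ 1 := by nlinarith
  have h2 : 0 ≤ u * (γ + k * (1 - u - α * w)) := mul_nonneg hu (by nlinarith)
  unfold FF; linarith

theorem FF_le {γ k α u w : ℝ} (hk : 0 < k) (hα : 0 ≤ α)
    (hu : 0 ≤ u) (hw : 0 ≤ w) : FF γ k α u w ≤ (γ + k) * u := by
  have h1 : 0 ≤ α * w := by positivity
  have h2 : 0 ≤ k * u * (u + α * w) := by positivity
  unfold FF; linarith

theorem FF_mono {γ k α u w u' w' : ℝ} (hk : 0 < k) (hγ : 2 * k ≤ γ) (hα : 0 ≤ α) (hα1 : α ≤ 1)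
    (hu' : 0 ≤ u') (hu1 : u ≤ 1) (huu : u ≤ u') (hu'1 : u' ≤ 1)
    (hw1 : w ≤ 1) (hww : w' ≤ w) : FF γ k α u w ≤ FF γ k α u' w' := by
  have h1 : α * w ≤ 1 := by nlinarith
  have h2 : 0 ≤ (u' - u) * (γ + k * (1 - u - u' - α * w)) :=
    mul_nonneg (by linarith) (by nlinarith)
  have h3 : 0 ≤ k * u' * (α * (w - w')) :=
    mul_nonneg (by positivity) (mul_nonneg hα (by linarith))
  unfold FF; nlinarith

theorem FF_le' {γ k α u w : ℝ} (hk : 0 < k) (hγ : 2 * k ≤ γ) (hα : 0 ≤ α) (hα1 : α ≤ 1)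
    (hu1 : u ≤ 1) (hw : 0 ≤ w) (hw1 : w ≤ 1) : FF γ k α u w ≤ γ := by
  have := FF_mono (u' := 1) (w' := 0) hk hγ hα hα1 (by norm_num) hu1 hu1 le_rfl hw1 hw
  unfold FF at *; linarith

theorem FF_abs {γ k α u w : ℝ} (hk : 0 < k) (hγ : 2 * k ≤ γ) (hα : 0 ≤ α) (hα1 : α ≤ 1)
    (hu : 0 ≤ u) (hu1 : u ≤ 1) (hw : 0 ≤ w) (hw1 : w ≤ 1) : |FF γ k α u w| ≤ γ := by
  rw [abs_of_nonneg (FF_nonneg hk hγ hα hα1 hu hu1 hw1)]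
  exact FF_le' hk hγ hα hα1 hu1 hw hw1

theorem KK_mono {p q B : ℝ} {f g : ℝ → ℝ} (hp : 0 < p) (hpq : p < q) (hf : Continuous f)
    (hg : Continuous g) (hfB : ∀ x, |f x| ≤ B) (hgB : ∀ x, |g x| ≤ B) (hfg : ∀ x, f x ≤ g x)
    (x : ℝ) : KK p q f x ≤ KK p q g x := by
  have hq : 0 < q := hp.trans hpq
  have key := maxp1 (I := Set.univ) (z := fun x => KK p q f x - KK p q g x)
    (z1 := fun x => KK1 p q f x - KK1 p q g x)
    (B := 2 * ((p + q)⁻¹ * (B / p + B / q))) isClosed_univ (sub_pos.2 hpq) (mul_pos hp hq)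
    (fun x => (KK_deriv hp hq hf hfB x).sub (KK_deriv hp hq hg hgB x))
    (fun x => (KK1_deriv hp hq hf hfB x).sub (KK1_deriv hp hq hg hgB x))
    (fun x _ => by
      have h1 := (abs_le.1 (KK_bd hp hq hfB x)).2
      have h2 := (abs_le.1 (KK_bd hp hq hgB x)).1
      linarith)
    (fun x _ _ => ⟨by simp, by have := hfg x; linarith⟩) x (Set.mem_univ x)
  linarith

section step
variable {p q k ε α M : ℝ} {P P1 P2 Q Q1 Q2 u w : ℝ → ℝ}

theorem lb_le_ub {σ : ℝ} (h : IsProf σ k ε P P1 P2 Q Q1 Q2 M) (x : ℝ) : lb Q x ≤ ub P x := by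
  unfold lb ub
  split_ifs with hx
  · exact max_le (h.Ppos x hx).le (h.QP x hx)
  · norm_num

theorem lb_nonneg (x : ℝ) : 0 ≤ lb Q x := by
  unfold lb
  split_ifs with hx
  · exact le_max_left _ _
  · exact le_rfl

theorem ub_le {σ : ℝ} (h : IsProf σ k ε P P1 P2 Q Q1 Q2 M) (x : ℝ) : ub P x ≤ 1 := by
  unfold ub
  split_ifs with hx
  · exact h.Ple x hx
  · exact le_rfl

theorem ub_le_exp {σ : ℝ} (h : IsProf σ k ε P P1 P2 Q Q1 Q2 M) (x : ℝ) (hx : x ≤ 0) :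
    ub P x ≤ 2 * exp (ε * x) := by
  unfold ub
  rw [if_pos hx]
  exact h.Pexp x hx

theorem ub_cont {σ : ℝ} (h : IsProf σ k ε P P1 P2 Q Q1 Q2 M) : Continuous (ub P) := by
  have hc : Continuous P := continuous_iff_continuousAt.2 fun x => (h.dP x).continuousAt
  refine Continuous.if_le hc continuous_const continuous_id continuous_const ?_
  rintro x rfl
  exact h.P0

theorem lb_cont {σ : ℝ} (h : IsProf σ k ε P P1 P2 Q Q1 Q2 M) : Continuous (lb Q) := by
  have hc : Continuous Q := continuous_iff_continuousAt.2 fun x => (h.dQ x).continuousAt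
  refine Continuous.if_le (continuous_const.max hc) continuous_const continuous_id
    continuous_const ?_
  rintro x rfl
  exact max_eq_left h.Q0

theorem step (hp : 0 < p) (hpq : p < q) (hk : 0 < k) (hγ : 2 * k ≤ p * q) (hα : 0 ≤ α)
    (hα1 : α ≤ 1) (h : IsProf (q - p) k ε P P1 P2 Q Q1 Q2 M)
    (hu : Continuous u) (hw : Continuous w)
    (hu1 : ∀ x, lb Q x ≤ u x) (hu2 : ∀ x, u x ≤ ub P x)
    (hw0 : ∀ x, 0 ≤ w x) (hw1 : ∀ x, w x ≤ 1) (hwe : ∀ x, x ≤ 0 → w x ≤ 2 * exp (ε * x)) :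
    (∀ x, lb Q x ≤ KK p q (fun t => FF (p * q) k α (u t) (w t)) x) ∧
    (∀ x, KK p q (fun t => FF (p * q) k α (u t) (w t)) x ≤ ub P x) := by
  have hq : 0 < q := hp.trans hpq
  have u0 : ∀ x, 0 ≤ u x := fun x => (lb_nonneg x).trans (hu1 x)
  have u1 : ∀ x, u x ≤ 1 := fun x => (hu2 x).trans (ub_le h x)
  obtain ⟨f, hf⟩ : ∃ f : ℝ → ℝ, f = fun t => FF (p * q) k α (u t) (w t) := ⟨_, rfl⟩
  rw [← hf]
  have hfc : Continuous f := by rw [hf]; unfold FF; fun_prop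
  have hfB : ∀ x, |f x| ≤ p * q := fun x => by
    rw [hf]; exact FF_abs hk hγ hα hα1 (u0 x) (u1 x) (hw0 x) (hw1 x)
  have d1 := KK_deriv hp hq hfc hfB
  have d2 := KK1_deriv hp hq hfc hfB
  have hσ : 0 < q - p := sub_pos.2 hpq
  have hg : 0 < p * q := mul_pos hp hq
  have bd := KK_bd hp hq hfB
  have a1 : ∀ x, KK p q f x - 1 ≤ 0 := fun x => by
    refine maxp1 (I := Set.univ) (B := (p + q)⁻¹ * (p * q / p + p * q / q))
      isClosed_univ hσ hg (fun x => (d1 x).sub_const 1) d2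
      (fun x _ => by have := (abs_le.1 (bd x)).2; linarith)
      (fun x _ _ => ⟨by simp, ?_⟩) x (Set.mem_univ x)
    have : f x ≤ p * q := (abs_le.1 (hfB x)).2
    linarith
  have a2 : ∀ x, -KK p q f x ≤ 0 := fun x => by
    refine maxp1 (I := Set.univ) (B := (p + q)⁻¹ * (p * q / p + p * q / q))
      isClosed_univ hσ hg (fun x => (d1 x).neg) (fun x => (d2 x).neg)
      (fun x _ => by have := (abs_le.1 (bd x)).1; show -KK p q f x ≤ _; linarith)
      (fun x _ _ => ⟨by simp, ?_⟩) x (Set.mem_univ x)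
    have : 0 ≤ f x := by rw [hf]; exact FF_nonneg hk hγ hα hα1 (u0 x) (u1 x) (hw1 x)
    show _ + _ * (-KK1 p q f x) + _ * (-KK p q f x) ≤ 0
    linarith
  have a3 : ∀ x ∈ Set.Iic (0:ℝ), KK p q f x - P x ≤ 0 := by
    refine maxp1 (B := 1) isClosed_Iic hσ hg (fun x => (d1 x).sub (h.dP x))
      (fun x => (d2 x).sub (h.dP1 x)) (fun x hx => ?_) (fun x hx hpos => ⟨?_, ?_⟩)
    · have := h.Ppos x hx; have := a1 x; linarith
    · rw [interior_Iic]
      refine Set.mem_Iio.2 (lt_of_le_of_ne (Set.mem_Iic.1 hx) ?_)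
      rintro rfl
      have := h.P0; have := a1 0; linarith
    · have e := h.eqP x
      have e1 : f x ≤ (p * q + k) * u x := by
        rw [hf]; exact FF_le hk hα (u0 x) (hw0 x)
      have e2 := hu2 x
      unfold ub at e2
      rw [if_pos (Set.mem_Iic.1 hx)] at e2
      have e3 := mul_le_mul_of_nonneg_left e2 (by linarith : 0 ≤ p * q + k)
      linarith
  have a4 : ∀ x ∈ Set.Iic (0:ℝ), Q x - KK p q f x ≤ 0 := by
    refine maxp1 (B := 1) isClosed_Iic hσ hg (fun x => (h.dQ x).sub (d1 x))
      (fun x => (h.dQ1 x).sub (d2 x)) (fun x hx => ?_) (fun x hx hpos => ⟨?_, ?_⟩)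
    · have := h.QP x hx; have := h.Ple x hx; have := a2 x; linarith
    · rw [interior_Iic]
      refine Set.mem_Iio.2 (lt_of_le_of_ne (Set.mem_Iic.1 hx) ?_)
      rintro rfl
      have := h.Q0; have := a2 0; linarith
    · have e := h.subQ x hx
      have hQ : 0 < Q x := by have := a2 x; linarith
      have e2 := hu1 x
      unfold lb at e2
      rw [if_pos (Set.mem_Iic.1 hx), max_eq_right hQ.le] at e2
      have e1 : FF (p * q) k α (Q x) (w x) ≤ f x := by
        rw [hf]
        exact FF_mono hk hγ hα hα1 (u0 x) (e2.trans (u1 x)) e2 (u1 x) (hw1 x) le_rfl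
      have hP := h.Ppos x hx
      have c1 := h.QP x hx
      have c2 := h.Pexp x hx
      have c3 := hwe x hx
      have c4 : Q x + α * w x ≤ 4 * exp (ε * x) := by
        have := hw0 x; nlinarith
      have c5 : k * (Q x * (Q x + α * w x)) ≤ k * (P x * (4 * exp (ε * x))) := by
        have : 0 ≤ α * w x := mul_nonneg hα (hw0 x)
        refine mul_le_mul_of_nonneg_left ?_ hk.le
        exact mul_le_mul c1 c4 (by linarith) hP.le
      unfold FF at e1
      linarith
  constructor
  · intro x
    unfold lb
    split_ifs with hx
    · exact max_le (by linarith [a2 x]) (by linarith [a4 x hx])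
    · linarith [a2 x]
  · intro x
    unfold ub
    split_ifs with hx
    · linarith [a3 x hx]
    · linarith [a1 x]

end step
theorem sys {σ1 k1 σ2 k2 β : ℝ} (hσ1 : 0 < σ1) (hk1 : 0 < k1) (h1 : 4 * k1 ≤ σ1 ^ 2)
    (hσ2 : 0 < σ2) (hk2 : 0 < k2) (h2 : 4 * k2 ≤ σ2 ^ 2) (hβ : 0 ≤ β) (hβ1 : β ≤ 1) :
    ∃ u w u1 w1 : ℝ → ℝ, (∀ x, HasDerivAt u (u1 x) x) ∧ (∀ x, HasDerivAt w (w1 x) x) ∧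
      (∀ x, HasDerivAt u1 (σ1 * u1 x - k1 * u x * (1 - u x - w x)) x) ∧
      (∀ x, HasDerivAt w1 (σ2 * w1 x - k2 * w x * (1 - w x - β * u x)) x) ∧
      (∀ x, 0 ≤ u x) ∧ (∀ x, u x ≤ 1) ∧ (∀ x, 0 ≤ w x) ∧ (∀ x, w x ≤ 1) ∧
      Tendsto u atBot (nhds 0) ∧ Tendsto w atBot (nhds 0) ∧ (∃ x, u x ≠ 0) ∧
      ∃ M, ∀ x, x ≤ M → 0 < w x := by
  obtain ⟨e1, he1, H1⟩ := prof hσ1 hk1 h1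
  obtain ⟨e2, he2, H2⟩ := prof hσ2 hk2 h2
  obtain ⟨ε, hε, hε1, hε2⟩ : ∃ ε : ℝ, 0 < ε ∧ ε ≤ e1 ∧ ε ≤ e2 :=
    ⟨min e1 e2, lt_min he1 he2, min_le_left _ _, min_le_right _ _⟩
  obtain ⟨P, P1, P2, Q, Q1, Q2, M, hP⟩ := H1 ε hε hε1
  obtain ⟨R, R1, R2, S, S1, S2, N, hR⟩ := H2 ε hε hε2
  obtain ⟨p1, q1, hp1, hpq1, hs1, hg1⟩ : ∃ p q : ℝ, 0 < p ∧ p < q ∧ σ1 = q - p ∧ 2 * k1 ≤ p * q :=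
    ⟨1 + 2 * k1, 1 + 2 * k1 + σ1, by linarith, by linarith, by ring, by nlinarith⟩
  obtain ⟨p2, q2, hp2, hpq2, hs2, hg2⟩ : ∃ p q : ℝ, 0 < p ∧ p < q ∧ σ2 = q - p ∧ 2 * k2 ≤ p * q :=
    ⟨1 + 2 * k2, 1 + 2 * k2 + σ2, by linarith, by linarith, by ring, by nlinarith⟩
  subst hs1 hs2
  have hq1 : 0 < q1 := hp1.trans hpq1
  have hq2 : 0 < q2 := hp2.trans hpq2
  obtain ⟨T1, hT1⟩ : ∃ T1 : (ℝ → ℝ) → (ℝ → ℝ) → (ℝ → ℝ), ∀ u w, T1 u w =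
    KK p1 q1 (fun t => FF (p1 * q1) k1 1 (u t) (w t)) := ⟨fun u w => _, fun u w => rfl⟩
  obtain ⟨T2, hT2⟩ : ∃ T2 : (ℝ → ℝ) → (ℝ → ℝ) → (ℝ → ℝ), ∀ u w, T2 u w =
    KK p2 q2 (fun t => FF (p2 * q2) k2 β (w t) (u t)) := ⟨fun u w => _, fun u w => rfl⟩
  let sq : ℕ → (ℝ → ℝ) × (ℝ → ℝ) := fun n =>
    Nat.rec (ub P, lb S) (fun _ x => (T1 x.1 x.2, T2 x.1 x.2)) n
  let u : ℕ → ℝ → ℝ := fun n => (sq n).1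
  let w : ℕ → ℝ → ℝ := fun n => (sq n).2
  have us : ∀ n, u (n + 1) = T1 (u n) (w n) := fun n => rfl
  have ws : ∀ n, w (n + 1) = T2 (u n) (w n) := fun n => rfl
  have u00 : u 0 = ub P := rfl
  have w00 : w 0 = lb S := rfl
  clear_value u w
  clear sq
  have bounds : ∀ {u w : ℝ → ℝ}, (∀ x, lb Q x ≤ u x) → (∀ x, u x ≤ ub P x) →
      (∀ x, lb S x ≤ w x) → (∀ x, w x ≤ ub R x) →
      (∀ x, 0 ≤ u x) ∧ (∀ x, u x ≤ 1) ∧ (∀ x, 0 ≤ w x) ∧ (∀ x, w x ≤ 1) ∧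
      (∀ x, x ≤ 0 → u x ≤ 2 * exp (ε * x)) ∧ (∀ x, x ≤ 0 → w x ≤ 2 * exp (ε * x)) := by
    intro u w a1 a2 a3 a4
    exact ⟨fun x => (lb_nonneg x).trans (a1 x), fun x => (a2 x).trans (ub_le hP x),
      fun x => (lb_nonneg x).trans (a3 x), fun x => (a4 x).trans (ub_le hR x),
      fun x hx => (a2 x).trans (ub_le_exp hP x hx), fun x hx => (a4 x).trans (ub_le_exp hR x hx)⟩
  have inv : ∀ n, Continuous (u n) ∧ Continuous (w n) ∧ (∀ x, lb Q x ≤ u n x) ∧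
      (∀ x, u n x ≤ ub P x) ∧ (∀ x, lb S x ≤ w n x) ∧ (∀ x, w n x ≤ ub R x) := by
    intro n
    induction n with
    | zero =>
      rw [u00, w00]
      exact ⟨ub_cont hP, lb_cont hR, lb_le_ub hP, fun x => le_rfl, fun x => le_rfl, lb_le_ub hR⟩
    | succ n ih =>
      obtain ⟨c1, c2, a1, a2, a3, a4⟩ := ih
      obtain ⟨b1, b2, b3, b4, b5, b6⟩ := bounds a1 a2 a3 a4
      rw [us, ws, hT1, hT2]
      obtain ⟨s1, s2⟩ := step hp1 hpq1 hk1 hg1 zero_le_one le_rfl hP c1 c2 a1 a2 b3 b4 b6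
      obtain ⟨s3, s4⟩ := step hp2 hpq2 hk2 hg2 hβ hβ1 hR c2 c1 a3 a4 b1 b2 b5
      refine ⟨?_, ?_, s1, s2, s3, s4⟩
      · refine KK_cont (B := p1 * q1) hp1 hq1 (Continuous.measurable ?_) fun x =>
          FF_abs hk1 hg1 zero_le_one le_rfl (b1 x) (b2 x) (b3 x) (b4 x)
        unfold FF; fun_prop
      · refine KK_cont (B := p2 * q2) hp2 hq2 (Continuous.measurable ?_) fun x =>
          FF_abs hk2 hg2 hβ hβ1 (b3 x) (b4 x) (b1 x) (b2 x)
        unfold FF; fun_prop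
  have uc := fun n => (inv n).1
  have wc := fun n => (inv n).2.1
  have bd := fun n => bounds (inv n).2.2.1 (inv n).2.2.2.1 (inv n).2.2.2.2.1 (inv n).2.2.2.2.2
  have hF1 : ∀ n x, |FF (p1 * q1) k1 1 (u n x) (w n x)| ≤ p1 * q1 := fun n x => by
    obtain ⟨b1, b2, b3, b4, b5, b6⟩ := bd n
    exact FF_abs hk1 hg1 zero_le_one le_rfl (b1 x) (b2 x) (b3 x) (b4 x)
  have hF2 : ∀ n x, |FF (p2 * q2) k2 β (w n x) (u n x)| ≤ p2 * q2 := fun n x => by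
    obtain ⟨b1, b2, b3, b4, b5, b6⟩ := bd n
    exact FF_abs hk2 hg2 hβ hβ1 (b3 x) (b4 x) (b1 x) (b2 x)
  have hC1 : ∀ n, Continuous fun x => FF (p1 * q1) k1 1 (u n x) (w n x) := fun n => by
    have := uc n; have := wc n; unfold FF; fun_prop
  have hC2 : ∀ n, Continuous fun x => FF (p2 * q2) k2 β (w n x) (u n x) := fun n => by
    have := uc n; have := wc n; unfold FF; fun_prop
  have mono : ∀ n, (∀ x, u (n + 1) x ≤ u n x) ∧ (∀ x, w n x ≤ w (n + 1) x) := by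
    intro n
    induction n with
    | zero =>
      constructor
      · intro x; have := (inv 1).2.2.2.1 x; rw [u00]; exact this
      · intro x; have := (inv 1).2.2.2.2.1 x; rw [w00]; exact this
    | succ n ih =>
      obtain ⟨i1, i2⟩ := ih
      obtain ⟨b1, b2, b3, b4, b5, b6⟩ := bd n
      obtain ⟨d1, d2, d3, d4, d5, d6⟩ := bd (n + 1)
      constructor
      · intro x
        have g1 := congrFun ((us (n + 1)).trans (hT1 _ _)) x
        have g2 := congrFun ((us n).trans (hT1 _ _)) x
        refine g1.trans_le (le_of_le_of_eq ?_ g2.symm)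
        exact KK_mono hp1 hpq1 (hC1 (n + 1)) (hC1 n) (hF1 (n + 1)) (hF1 n) (fun t =>
          FF_mono hk1 hg1 zero_le_one le_rfl (b1 t) (d2 t) (i1 t) (b2 t) (d4 t) (i2 t)) x
      · intro x
        have g1 := congrFun ((ws (n + 1)).trans (hT2 _ _)) x
        have g2 := congrFun ((ws n).trans (hT2 _ _)) x
        refine g2.trans_le (le_of_le_of_eq ?_ g1.symm)
        exact KK_mono hp2 hpq2 (hC2 n) (hC2 (n + 1)) (hF2 n) (hF2 (n + 1)) (fun t =>
          FF_mono hk2 hg2 hβ hβ1 (d3 t) (b4 t) (i2 t) (d4 t) (b2 t) (i1 t)) x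
  have limu : ∀ x, ∃ l, Tendsto (fun n => u n x) atTop (nhds l) := fun x =>
    ⟨_, tendsto_atTop_ciInf (antitone_nat_of_succ_le fun n => (mono n).1 x)
      ⟨0, by rintro _ ⟨n, rfl⟩; exact (bd n).1 x⟩⟩
  have limw : ∀ x, ∃ l, Tendsto (fun n => w n x) atTop (nhds l) := fun x =>
    ⟨_, tendsto_atTop_ciSup (monotone_nat_of_le_succ fun n => (mono n).2 x)
      ⟨1, by rintro _ ⟨n, rfl⟩; exact (bd n).2.2.2.1 x⟩⟩
  choose U hU using limu
  choose W hW using limw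
  have UQ : ∀ x, lb Q x ≤ U x := fun x => ge_of_tendsto' (hU x) fun n => (inv n).2.2.1 x
  have UP : ∀ x, U x ≤ ub P x := fun x => le_of_tendsto' (hU x) fun n => (inv n).2.2.2.1 x
  have WS : ∀ x, lb S x ≤ W x := fun x => ge_of_tendsto' (hW x) fun n => (inv n).2.2.2.2.1 x
  have WR : ∀ x, W x ≤ ub R x := fun x => le_of_tendsto' (hW x) fun n => (inv n).2.2.2.2.2 x
  obtain ⟨b1, b2, b3, b4, b5, b6⟩ := bounds UQ UP WS WR
  have mU : Measurable U := measurable_of_tendsto_metrizable (fun n => (uc n).measurable)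
    (tendsto_pi_nhds.2 hU)
  have mW : Measurable W := measurable_of_tendsto_metrizable (fun n => (wc n).measurable)
    (tendsto_pi_nhds.2 hW)
  have fU : U = KK p1 q1 (fun t => FF (p1 * q1) k1 1 (U t) (W t)) := by
    funext x
    refine tendsto_nhds_unique ((tendsto_add_atTop_iff_nat 1).2 (hU x)) ?_
    simp only [us, hT1]
    refine KK_lim hp1 hq1 (fun n => (hC1 n).measurable) hF1 (fun t => ?_) x
    unfold FF
    exact ((hU t).const_mul _).add (((hU t).const_mul _).mul
      (((hU t).const_sub 1).sub ((hW t).const_mul 1)))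
  have fW : W = KK p2 q2 (fun t => FF (p2 * q2) k2 β (W t) (U t)) := by
    funext x
    refine tendsto_nhds_unique ((tendsto_add_atTop_iff_nat 1).2 (hW x)) ?_
    simp only [ws, hT2]
    refine KK_lim hp2 hq2 (fun n => (hC2 n).measurable) hF2 (fun t => ?_) x
    unfold FF
    exact ((hW t).const_mul _).add (((hW t).const_mul _).mul
      (((hW t).const_sub 1).sub ((hU t).const_mul β)))
  have B1 : ∀ x, |FF (p1 * q1) k1 1 (U x) (W x)| ≤ p1 * q1 := fun x =>
    FF_abs hk1 hg1 zero_le_one le_rfl (b1 x) (b2 x) (b3 x) (b4 x)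
  have B2 : ∀ x, |FF (p2 * q2) k2 β (W x) (U x)| ≤ p2 * q2 := fun x =>
    FF_abs hk2 hg2 hβ hβ1 (b3 x) (b4 x) (b1 x) (b2 x)
  have cU : Continuous U := by
    rw [fU]; exact KK_cont hp1 hq1 (by unfold FF; fun_prop) B1
  have cW : Continuous W := by
    rw [fW]; exact KK_cont hp2 hq2 (by unfold FF; fun_prop) B2
  have C1 : Continuous fun x => FF (p1 * q1) k1 1 (U x) (W x) := by unfold FF; fun_prop
  have C2 : Continuous fun x => FF (p2 * q2) k2 β (W x) (U x) := by unfold FF; fun_prop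
  have elim : Tendsto (fun x : ℝ => 2 * exp (ε * x)) atBot (nhds 0) := by
    have : Tendsto (fun x : ℝ => exp (ε * x)) atBot (nhds 0) :=
      tendsto_exp_atBot.comp (tendsto_id.const_mul_atBot hε)
    simpa using this.const_mul 2
  refine ⟨U, W, KK1 p1 q1 (fun t => FF (p1 * q1) k1 1 (U t) (W t)),
    KK1 p2 q2 (fun t => FF (p2 * q2) k2 β (W t) (U t)), ?_, ?_, ?_, ?_, b1, b2, b3, b4, ?_, ?_,
    ⟨M, ?_⟩, N, ?_⟩
  · intro x
    have := KK_deriv hp1 hq1 C1 B1 x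
    rwa [← fU] at this
  · intro x
    have := KK_deriv hp2 hq2 C2 B2 x
    rwa [← fW] at this
  · intro x
    refine (KK1_deriv hp1 hq1 C1 B1 x).congr_deriv ?_
    rw [← fU]; unfold FF; ring
  · intro x
    refine (KK1_deriv hp2 hq2 C2 B2 x).congr_deriv ?_
    rw [← fW]; unfold FF; ring
  · refine tendsto_of_tendsto_of_tendsto_of_le_of_le' tendsto_const_nhds elim
      (Eventually.of_forall b1) ?_
    filter_upwards [eventually_le_atBot 0] with x hx using b5 x hx
  · refine tendsto_of_tendsto_of_tendsto_of_le_of_le' tendsto_const_nhds elim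
      (Eventually.of_forall b3) ?_
    filter_upwards [eventually_le_atBot 0] with x hx using b6 x hx
  · have h3 := UQ M
    unfold lb at h3
    rw [if_pos hP.M0] at h3
    exact ((hP.Qpos M le_rfl).trans_le ((le_max_right _ _).trans h3)).ne'
  · intro x hx
    have h3 := WS x
    unfold lb at h3
    rw [if_pos (hx.trans hR.M0)] at h3
    exact (hR.Qpos x hx).trans_le ((le_max_right _ _).trans h3)

theorem endgame {σ1 k1 σ2 k2 β : ℝ} (hσ1 : 0 < σ1) (hk1 : 0 < k1)
    (hσ2 : 0 < σ2) (hk2 : 0 < k2) (hβ : 0 < β) (hβ1 : β < 1)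
    {u w u1 w1 : ℝ → ℝ} (du : ∀ x, HasDerivAt u (u1 x) x) (dw : ∀ x, HasDerivAt w (w1 x) x)
    (du1 : ∀ x, HasDerivAt u1 (σ1 * u1 x - k1 * u x * (1 - u x - w x)) x)
    (dw1 : ∀ x, HasDerivAt w1 (σ2 * w1 x - k2 * w x * (1 - w x - β * u x)) x)
    (u0 : ∀ x, 0 ≤ u x) (uo : ∀ x, u x ≤ 1) (w0 : ∀ x, 0 ≤ w x) (wo : ∀ x, w x ≤ 1)
    {M : ℝ} (hM : ∀ x, x ≤ M → 0 < w x) :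
    (∀ x, 0 < w x) ∧ Tendsto u atTop (nhds 0) ∧ Tendsto w atTop (nhds 1) := by
  obtain ⟨m, hm, hmM, hmβ⟩ : ∃ m : ℝ, 0 < m ∧ m ≤ w M ∧ m ≤ 1 - β :=
    ⟨min (w M) (1 - β), lt_min (hM M le_rfl) (by linarith), min_le_left _ _, min_le_right _ _⟩
  have pers : ∀ x, M ≤ x → m - w x ≤ 0 := by
    refine maxp2 (B := m) hσ2 (fun x => (dw x).const_sub m) (fun x => (dw1 x).neg)
      (fun x _ => by have := w0 x; linarith) (fun x hx hpos => ⟨?_, ?_⟩)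
    · refine lt_of_le_of_ne hx ?_
      rintro rfl
      linarith
    · have : 0 ≤ k2 * w x * (1 - w x - β * u x) := by
        refine mul_nonneg (mul_nonneg hk2.le (w0 x)) ?_
        have := uo x
        nlinarith
      show _ + σ2 * (-w1 x) ≤ 0
      linarith
  have wm : ∀ x, M ≤ x → m ≤ w x := fun x hx => by linarith [pers x hx]
  -- from a lower bound on w to an upper bound on u
  have A : ∀ L ε : ℝ, L ≤ 1 → 0 < ε → (∀ᶠ x in atTop, L ≤ w x) →
      ∀ᶠ x in atTop, u x ≤ 1 - L + 2 * ε := by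
    intro L ε hL1 hε hL
    obtain ⟨R, hR⟩ := eventually_atTop.1 hL
    have := decay (R := R) (B := 1) (l := 1 - L + ε) (δ := k1 * ε * ε) hσ1 (by positivity) du du1
      (fun x _ => uo x) (fun x hx hlt => ?_) hε
    · filter_upwards [this] with x hx; linarith
    · have h1 := hR x hx
      have h2 : ε ≤ u x := by linarith
      have h3 : ε ≤ u x + w x - 1 := by linarith
      have h4 : k1 * ε * ε ≤ k1 * u x * (u x + w x - 1) :=
        mul_le_mul (by nlinarith) h3 hε.le (mul_nonneg hk1.le (u0 x))
      linarith
  have Bw : ∀ V ε : ℝ, 0 < ε → (∀ᶠ x in atTop, u x ≤ V) →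
      ∀ᶠ x in atTop, 1 - β * V - 2 * ε ≤ w x := by
    intro V ε hε hV
    obtain ⟨R, hR⟩ := eventually_atTop.1 hV
    have := decay (R := max R M) (z := fun x => -w x) (B := 0) (l := -(1 - β * V - ε))
      (δ := k2 * m * ε) hσ2 (by positivity) (fun x => (dw x).neg) (fun x => (dw1 x).neg)
      (fun x _ => by have := w0 x; show -w x ≤ 0; linarith) (fun x hx hlt => ?_) hε
    · filter_upwards [this] with x hx; linarith
    · have h1 := hR x ((le_max_left _ _).trans hx)
      have h2 := wm x ((le_max_right _ _).trans hx)
      have h3 : ε ≤ 1 - w x - β * u x := by nlinarith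
      have h4 : k2 * m * ε ≤ k2 * w x * (1 - w x - β * u x) :=
        mul_le_mul (by nlinarith) h3 hε.le (mul_nonneg hk2.le (w0 x))
      show _ + σ2 * (-w1 x) ≤ _
      linarith
  have key : ∀ L : ℝ, L < 1 → ∀ᶠ x in atTop, L ≤ w x := by
    obtain ⟨S, hS⟩ : ∃ S : Set ℝ, S = {L | ∀ᶠ x in atTop, L ≤ w x} := ⟨_, rfl⟩
    have hSb : ∀ L ∈ S, L ≤ 1 := by
      intro L hL
      rw [hS] at hL
      obtain ⟨x, hx⟩ := (show ∀ᶠ x in atTop, L ≤ w x from hL).exists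
      exact hx.trans (wo x)
    have h0 : (0:ℝ) ∈ S := by rw [hS]; exact Eventually.of_forall w0
    have hlub := isLUB_csSup ⟨0, h0⟩ ⟨1, hSb⟩
    obtain ⟨l, hl⟩ : ∃ l, l = sSup S := ⟨_, rfl⟩
    rw [← hl] at hlub
    have hl1 : l ≤ 1 := hlub.2 hSb
    have hlt : ∀ L, L < l → ∀ᶠ x in atTop, L ≤ w x := by
      intro L hL
      obtain ⟨L', hL', h3, _⟩ := hlub.exists_between hL
      rw [hS] at hL'
      filter_upwards [show ∀ᶠ x in atTop, L' ≤ w x from hL'] with x hx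
      linarith
    have hge : 1 ≤ l := by
      by_contra hcon
      push Not at hcon
      obtain ⟨ε, hε⟩ : ∃ ε, ε = (1 - β) * (1 - l) / 10 := ⟨_, rfl⟩
      have hε0 : 0 < ε := by
        rw [hε]; exact div_pos (mul_pos (by linarith) (by linarith)) (by norm_num)
      have s1 := A (l - ε) ε (by linarith) hε0 (hlt _ (by linarith))
      have s2 := Bw _ ε hε0 s1
      have s3 : 1 - β * (1 - (l - ε) + 2 * ε) - 2 * ε ∈ S := by rw [hS]; exact s2
      have s4 := hlub.1 s3
      nlinarith
    exact fun L hL => hlt L (by linarith)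
  refine ⟨?_, ?_, ?_⟩
  · intro x
    rcases le_total x M with h | h
    · exact hM x h
    · exact hm.trans_le (wm x h)
  · rw [tendsto_order]
    refine ⟨fun b hb => Eventually.of_forall fun x => hb.trans_le (u0 x), fun b hb => ?_⟩
    filter_upwards [A (1 - b / 4) (b / 4) (by linarith) (by linarith) (key _ (by linarith))]
      with x hx
    linarith
  · rw [tendsto_order]
    refine ⟨fun b hb => ?_, fun b hb => Eventually.of_forall fun x => (wo x).trans_lt hb⟩
    filter_upwards [key ((1 + b) / 2) (by linarith)] with x hx
    linarith

theorem contDiff_two {f f1 f2 : ℝ → ℝ} (h1 : ∀ x, HasDerivAt f (f1 x) x)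
    (h2 : ∀ x, HasDerivAt f1 (f2 x) x) (hc : Continuous f2) : ContDiff ℝ 2 f := by
  have e1 : deriv f = f1 := funext fun x => (h1 x).deriv
  have e2 : deriv f1 = f2 := funext fun x => (h2 x).deriv
  have c1 : ContDiff ℝ 1 f1 := by
    rw [contDiff_one_iff_deriv]
    exact ⟨fun x => (h2 x).differentiableAt, by rw [e2]; exact hc⟩
  have : ContDiff ℝ (1 + 1) f := by
    rw [contDiff_succ_iff_deriv]
    refine ⟨fun x => (h1 x).differentiableAt, by simp, by rw [e1]; exact c1⟩
  simpa [one_add_one_eq_two] using this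
/-- Existence of a non-trivial front-pulse solution in the critical weak
competition case `b < a = 1/c` (`a·c = 1`): the `u`-component is a nontrivial
pulse tending to `0` at both ends, while `v` connects `0` to `a`. -/
theorem front_pulse_u
    (a b c d : ℝ) (hb : 0 < b) (hba : b < a) (hac : a * c = 1) (hd : 0 < d)
    (s : ℝ) (hs : max 2 (2 * Real.sqrt (a * d)) ≤ s) :
    ∃ u v : ℝ → ℝ, ContDiff ℝ 2 u ∧ ContDiff ℝ 2 v ∧
      (∀ ξ : ℝ, 0 ≤ u ξ) ∧ (∀ ξ : ℝ, 0 < v ξ) ∧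
      (∃ ξ : ℝ, u ξ ≠ 0) ∧
      (∀ ξ : ℝ, deriv (deriv u) ξ - s * deriv u ξ + u ξ * (1 - u ξ - (1 / a) * v ξ) = 0) ∧
      (∀ ξ : ℝ, d * deriv (deriv v) ξ - s * deriv v ξ + v ξ * (a - b * u ξ - v ξ) = 0) ∧
      Tendsto u atBot (nhds 0) ∧ Tendsto v atBot (nhds 0) ∧
      Tendsto u atTop (nhds 0) ∧ Tendsto v atTop (nhds a) := by
  have ha : 0 < a := hb.trans hba
  have hs2 : 2 ≤ s := (le_max_left _ _).trans hs
  have hsd : 2 * Real.sqrt (a * d) ≤ s := (le_max_right _ _).trans hs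
  have hs0 : 0 < s := by linarith
  have h4 : 4 * (a * d) ≤ s ^ 2 := by
    have h := Real.sq_sqrt (mul_pos ha hd).le
    have h0 := Real.sqrt_nonneg (a * d)
    nlinarith
  have hβ0 : 0 < b / a := by positivity
  have hβ1 : b / a < 1 := (div_lt_one ha).2 hba
  obtain ⟨u, w, u1, w1, du, dw, du1, dw1, u0, uo, w0, wo, ub0, wb0, une, M, hM⟩ :=
    sys (σ1 := s) (k1 := 1) (σ2 := s / d) (k2 := a / d) (β := b / a) hs0 one_pos (by nlinarith)
      (by positivity) (by positivity) (by
        rw [div_pow, mul_div_assoc', div_le_div_iff₀ hd (by positivity)]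
        nlinarith [mul_le_mul_of_nonneg_right h4 hd.le]) hβ0.le hβ1.le
  obtain ⟨wpos, ut, wt⟩ := endgame hs0 one_pos (by positivity) (by positivity) hβ0 hβ1
    du dw du1 dw1 u0 uo w0 wo hM
  have cu : Continuous u := continuous_iff_continuousAt.2 fun x => (du x).continuousAt
  have cw : Continuous w := continuous_iff_continuousAt.2 fun x => (dw x).continuousAt
  have cu1 : Continuous u1 := continuous_iff_continuousAt.2 fun x => (du1 x).continuousAt
  have cw1 : Continuous w1 := continuous_iff_continuousAt.2 fun x => (dw1 x).continuousAt
  have dv : ∀ x, HasDerivAt (fun x => a * w x) (a * w1 x) x := fun x => (dw x).const_mul a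
  have dv1 := fun x => (dw1 x).const_mul a
  refine ⟨u, fun x => a * w x, contDiff_two du du1 (by fun_prop),
    contDiff_two dv dv1 (by fun_prop), u0, fun x => mul_pos ha (wpos x), une, ?_, ?_,
    ub0, by simpa using wb0.const_mul a, ut, by simpa using wt.const_mul a⟩
  · intro x
    rw [show deriv u = u1 from funext fun x => (du x).deriv, (du1 x).deriv]
    field_simp
    ring
  · intro x
    rw [show deriv (fun x => a * w x) = fun x => a * w1 x from funext fun x => (dv x).deriv,
      (dv1 x).deriv]
    field_simp
    ring
end
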